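/- Let 2 ≤ p < ∞ and let X = ℓ_p be the real sequence space with norm ‖x‖_p = (Σ_{i=1}^∞ |x_i|^p)^{1/p}. For every A > 1 there exists a constant C > 0, depending only on A and p, such that for every rectifiable curve Γ ⊆ ℓ_p, every nonempty E ⊆ Γ, and every partial multiresolution family G for E with inflation factor A, one has diam E + Σ_{Q ∈ G} β_E(Q)^p·diam Q ≤ C·H^1(Γ). -/

import Mathlib

open Metric MeasureTheory Set Bornology
open scoped ENNReal NNReal Classical

universe u

noncomputable section

/-- The affine line through `a` with direction `v`. -/
def lineThrough {X : Type u} [AddCommGroup X] [Module ℝ X] (a v : X) : Set X :=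
  {y | ∃ t : ℝ, y = a + t • v}

/-- The Jones beta number of `E` in the window `Q`. -/
def jonesBeta {X : Type u} [NormedAddCommGroup X] [NormedSpace ℝ X] (E Q : Set X) : ℝ :=
  if E ∩ Q = ∅ then 0
  else sInf {r : ℝ | ∃ a v : X, v ≠ 0 ∧
    r = sSup ((fun x => infDist x (lineThrough a v) / Metric.diam Q) '' (E ∩ Q))}

/-- `net` encodes a partial multiresolution family for `E`. -/
def IsPartialMultiresolution {X : Type u} [NormedAddCommGroup X]
    (E : Set X) (net : ℤ → Set X) : Prop :=
  (∀ k, net k ⊆ E) ∧ (∀ k, net k ⊆ net (k + 1)) ∧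
    (∀ k : ℤ, ∀ x ∈ net k, ∀ y ∈ net k, x ≠ y → (2 : ℝ) ^ (-k) ≤ dist x y)

/-- `net` encodes a multiresolution family for `E`. -/
def IsMultiresolution {X : Type u} [NormedAddCommGroup X]
    (E : Set X) (net : ℤ → Set X) : Prop :=
  IsPartialMultiresolution E net ∧ ∀ k : ℤ, ∀ e ∈ E, ∃ x ∈ net k, dist e x ≤ (2 : ℝ) ^ (-k)

/-- The sum `Σ_{Q ∈ G} β_E(Q)^p · diam Q`. -/
def betaSum {X : Type u} [NormedAddCommGroup X] [NormedSpace ℝ X]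
    (E : Set X) (net : ℤ → Set X) (A p : ℝ) : ℝ≥0∞ :=
  ∑' (k : ℤ), ∑' (x : net k),
    ENNReal.ofReal (jonesBeta E (closedBall (x : X) (A * (2 : ℝ) ^ (-k))) ^ p *
      Metric.diam (closedBall (x : X) (A * (2 : ℝ) ^ (-k))))

/-- `S_{E,p}(G) = diam E + Σ_{Q ∈ G} β_E(Q)^p · diam Q`. -/
def SEp {X : Type u} [NormedAddCommGroup X] [NormedSpace ℝ X]
    (E : Set X) (net : ℤ → Set X) (A p : ℝ) : ℝ≥0∞ :=
  ENNReal.ofReal (Metric.diam E) + betaSum E net A p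

/-- `Γ` is a rectifiable curve. -/
def IsRectifiableCurve {X : Type u} [NormedAddCommGroup X]
    [MeasurableSpace X] [BorelSpace X] (Γ : Set X) : Prop :=
  (∃ f : ℝ → X, ContinuousOn f (Set.Icc (0 : ℝ) 1) ∧ Γ = f '' Set.Icc (0 : ℝ) 1) ∧
    μH[1] Γ < ⊤

/-- The sequence space `ℓ_p` over `ℝ`. -/
abbrev ellp (p : ℝ) : Type := ↥(lp (fun _ : ℕ => ℝ) (ENNReal.ofReal p))

/-- The scalar form of Clarkson's inequality. -/
theorem abs_add_rpow_add_abs_sub_rpow_le {p : ℝ} (hp : 2 ≤ p) (a b : ℝ) :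
    |a + b| ^ p + |a - b| ^ p ≤ 2 ^ (p - 1) * (|a| ^ p + |b| ^ p) := by
  have key : ∀ x : ℝ, |x| ^ p = (x ^ 2) ^ (p / 2) := by
    intro x
    rw [← sq_abs, ← Real.rpow_natCast, ← Real.rpow_mul (abs_nonneg x)]
    congr 1; push_cast; ring
  have h1 : ((a + b) ^ 2) ^ (p / 2) + ((a - b) ^ 2) ^ (p / 2)
      ≤ ((a + b) ^ 2 + (a - b) ^ 2) ^ (p / 2) :=
    Real.add_rpow_le_rpow_add (sq_nonneg _) (sq_nonneg _) (by linarith)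
  have h2 : (a ^ 2 + b ^ 2) ^ (p / 2) ≤
      2 ^ (p / 2 - 1) * ((a ^ 2) ^ (p / 2) + (b ^ 2) ^ (p / 2)) := by
    have := NNReal.rpow_add_le_mul_rpow_add_rpow ⟨a ^ 2, sq_nonneg a⟩ ⟨b ^ 2, sq_nonneg b⟩
      (p := p / 2) (by linarith)
    exact_mod_cast this
  have h3 : (a + b) ^ 2 + (a - b) ^ 2 = 2 * (a ^ 2 + b ^ 2) := by ring
  rw [key, key, key, key]
  calc _ ≤ _ := h1
    _ = 2 ^ (p / 2) * (a ^ 2 + b ^ 2) ^ (p / 2) := by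
      rw [h3, Real.mul_rpow (by norm_num) (by positivity)]
    _ ≤ 2 ^ (p / 2) * (2 ^ (p / 2 - 1) * ((a ^ 2) ^ (p / 2) + (b ^ 2) ^ (p / 2))) := by gcongr
    _ = _ := by
      rw [← mul_assoc, ← Real.rpow_add (by norm_num)]
      congr 2; ring

/-- Clarkson's inequality in `ℓ_p` for `2 ≤ p`. -/
theorem ellp_clarkson {p : ℝ} (hp : 2 ≤ p) [Fact (1 ≤ ENNReal.ofReal p)] (x y : ellp p) :
    ‖x + y‖ ^ p + ‖x - y‖ ^ p ≤ 2 ^ (p - 1) * (‖x‖ ^ p + ‖y‖ ^ p) := by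
  have hp0 : (ENNReal.ofReal p).toReal = p := ENNReal.toReal_ofReal (by linarith)
  have hpos : 0 < (ENNReal.ofReal p).toReal := by rw [hp0]; linarith
  have hs : ∀ z : ellp p, HasSum (fun i => |z i| ^ p) (‖z‖ ^ p) := by
    intro z
    have := lp.hasSum_norm hpos z
    simpa [hp0, Real.norm_eq_abs] using this
  refine hasSum_le (fun i => ?_) ((hs (x + y)).add (hs (x - y)))
    (((hs x).add (hs y)).mul_left (2 ^ (p - 1)))
  simpa using abs_add_rpow_add_abs_sub_rpow_le hp (x i) (y i)

/-- The triangle inequality defect controls the distance to a segment with exponent `p`. -/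
def HasExcessBound (X : Type u) [NormedAddCommGroup X] [NormedSpace ℝ X] (p c : ℝ) : Prop :=
  ∀ (u w v : X) (D : ℝ), min (dist u w) (dist w v) ≤ D →
    c * infDist w (segment ℝ u v) ^ p ≤ D ^ (p - 1) * (dist u w + dist w v - dist u v)

theorem hasExcessBound_aux {X : Type u} [NormedAddCommGroup X] [NormedSpace ℝ X] {p : ℝ}
    (hp : 2 ≤ p)
    (hX : ∀ x y : X, ‖x + y‖ ^ p + ‖x - y‖ ^ p ≤ 2 ^ (p - 1) * (‖x‖ ^ p + ‖y‖ ^ p))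
    (u w v : X) (D : ℝ) (hD : dist u w ≤ D) (hle : dist u w ≤ dist w v) :
    2 / (p * 2 ^ p) * infDist w (segment ℝ u v) ^ p ≤
      D ^ (p - 1) * (dist u w + dist w v - dist u v) := by
  have hp0 : 0 < p := by linarith
  have hD0 : 0 ≤ D := dist_nonneg.trans hD
  have he0 : 0 ≤ dist u w + dist w v - dist u v := by linarith [dist_triangle u w v]
  rcases eq_or_ne u w with rfl | hne
  · rw [infDist_zero_of_mem (left_mem_segment ℝ _ _), Real.zero_rpow hp0.ne', mul_zero]
    positivity
  set α := dist u w with hα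
  set β := dist w v with hβ
  have hα0 : 0 < α := dist_pos.2 hne
  have hβ0 : 0 < β := hα0.trans_le hle
  set e₁ : X := α⁻¹ • (w - u) with he₁
  set e₂ : X := β⁻¹ • (v - w) with he₂
  have hn1 : ‖e₁‖ = 1 := by
    rw [he₁, norm_smul, norm_inv, Real.norm_of_nonneg hα0.le, hα, dist_comm, dist_eq_norm]
    rw [hα, dist_comm, dist_eq_norm] at hα0
    exact inv_mul_cancel₀ hα0.ne'
  have hn2 : ‖e₂‖ = 1 := by
    rw [he₂, norm_smul, norm_inv, Real.norm_of_nonneg hβ0.le, hβ, dist_comm, dist_eq_norm]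
    rw [hβ, dist_comm, dist_eq_norm] at hβ0
    exact inv_mul_cancel₀ hβ0.ne'
  have hw1 : w - u = α • e₁ := by rw [he₁, smul_smul, mul_inv_cancel₀ hα0.ne', one_smul]
  have hw2 : v - w = β • e₂ := by rw [he₂, smul_smul, mul_inv_cancel₀ hβ0.ne', one_smul]
  set η := ‖e₁ - e₂‖ with hη
  set s := ‖e₁ + e₂‖ / 2 with hs
  have hη0 : 0 ≤ η := norm_nonneg _
  have hs0 : 0 ≤ s := by positivity
  have hcl : s ^ p + (η / 2) ^ p ≤ 1 := by
    have h := hX e₁ e₂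
    rw [hn1, hn2, Real.one_rpow, show (1 : ℝ) + 1 = 2 by norm_num] at h
    have h2 : (2 : ℝ) ^ (p - 1) * 2 = 2 ^ p := by
      rw [← Real.rpow_add_one (by norm_num)]; congr 1; ring
    rw [h2] at h
    rw [hs, Real.div_rpow (norm_nonneg _) (by norm_num), Real.div_rpow hη0 (by norm_num),
      ← add_div, div_le_one (by positivity)]
    exact h
  have hbern : 1 + p * (s - 1) ≤ s ^ p := by
    have := one_add_mul_self_le_rpow_one_add (s := s - 1) (by linarith) (p := p) (by linarith)
    simpa using this
  have hexc : α * (2 / p * (η / 2) ^ p) ≤ α + β - dist u v := by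
    have h1 : dist u v ≤ α * (2 * s) + (β - α) := by
      have : v - u = α • (e₁ + e₂) + (β - α) • e₂ := by
        rw [smul_add, sub_smul, ← hw1, ← hw2]; abel
      rw [dist_comm, dist_eq_norm, this]
      refine (norm_add_le _ _).trans ?_
      rw [norm_smul, norm_smul, hn2, Real.norm_of_nonneg hα0.le,
        Real.norm_of_nonneg (by linarith), hs]
      linarith
    have h2 : (η / 2) ^ p ≤ p * (1 - s) := by linarith
    have h3 : 2 / p * (η / 2) ^ p ≤ 2 * (1 - s) := by
      rw [div_mul_eq_mul_div, div_le_iff₀ hp0]; linarith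
    nlinarith
  have hd : infDist w (segment ℝ u v) ≤ α * η := by
    have hmem : u + (α / (α + β)) • (v - u) ∈ segment ℝ u v := by
      rw [segment_eq_image']
      exact ⟨_, ⟨by positivity, by rw [div_le_one (by positivity)]; linarith⟩, rfl⟩
    refine (infDist_le_dist_of_mem hmem).trans ?_
    have : w - (u + (α / (α + β)) • (v - u)) = (α * (β / (α + β))) • (e₁ - e₂) := by
      have h1 : v - u = α • e₁ + β • e₂ := by rw [← hw1, ← hw2]; abel
      have h2 : w - (u + (α / (α + β)) • (v - u)) = (w - u) - (α / (α + β)) • (v - u) := by abel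
      rw [h2, h1, hw1]
      clear_value e₁ e₂ α β
      have : α + β ≠ 0 := by positivity
      match_scalars <;> field_simp <;> ring
    rw [dist_eq_norm, this, norm_smul, Real.norm_of_nonneg (by positivity)]
    have : β / (α + β) ≤ 1 := by rw [div_le_one (by positivity)]; linarith
    have h4 : α * (β / (α + β)) ≤ α * 1 := by gcongr
    rw [mul_one] at h4
    gcongr
  have hfin : 2 / (p * 2 ^ p) * (α * η) ^ p = α ^ (p - 1) * (α * (2 / p * (η / 2) ^ p)) := by
    rw [Real.mul_rpow hα0.le hη0, Real.div_rpow hη0 (by norm_num)]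
    have : α ^ p = α ^ (p - 1) * α := by
      rw [← Real.rpow_add_one hα0.ne']; congr 1; ring
    rw [this]
    field_simp
  calc _ ≤ 2 / (p * 2 ^ p) * (α * η) ^ p := by gcongr; exact infDist_nonneg
    _ = _ := hfin
    _ ≤ α ^ (p - 1) * (α + β - dist u v) := by gcongr
    _ ≤ _ := by gcongr; linarith

theorem hasExcessBound_of_clarkson {X : Type u} [NormedAddCommGroup X] [NormedSpace ℝ X] {p : ℝ}
    (hp : 2 ≤ p)
    (hX : ∀ x y : X, ‖x + y‖ ^ p + ‖x - y‖ ^ p ≤ 2 ^ (p - 1) * (‖x‖ ^ p + ‖y‖ ^ p)) :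
    HasExcessBound X p (2 / (p * 2 ^ p)) := by
  intro u w v D hD
  rcases le_total (dist u w) (dist w v) with h | h
  · exact hasExcessBound_aux hp hX u w v D (by rwa [min_eq_left h] at hD) h
  · have := hasExcessBound_aux hp hX v w u D (by rwa [min_eq_right h, dist_comm] at hD)
      (by rwa [dist_comm v w, dist_comm w u])
    rw [segment_symm, dist_comm v w, dist_comm w u, dist_comm v u, add_comm] at this
    exact this

theorem ofReal_le_volume_image_dist {X : Type*} [PseudoMetricSpace X] {Γ : Set X}
    (hc : IsPreconnected Γ) {v z : X} {r : ℝ} (hv : v ∈ Γ) (hz : z ∈ Γ) (hr : r ≤ dist z v) :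
    ENNReal.ofReal r ≤ volume ((fun y => dist y v) '' (Γ ∩ ball v r)) := by
  have hsub : Ico 0 r ⊆ (fun y => dist y v) '' (Γ ∩ ball v r) := by
    intro t ht
    have hcont : ContinuousOn (fun y => dist y v) Γ := by fun_prop
    have h := hc.intermediate_value hv hz hcont
    obtain ⟨y, hy, hyt⟩ := h ⟨by simpa using ht.1, ht.2.le.trans hr⟩
    exact ⟨y, ⟨hy, by rw [mem_ball]; exact hyt.trans_lt ht.2⟩, hyt⟩
  calc ENNReal.ofReal r = volume (Ico 0 r) := by simp
    _ ≤ _ := measure_mono hsub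

theorem volume_image_le_hausdorffMeasure {X : Type*} [MetricSpace X] [MeasurableSpace X]
    [BorelSpace X] {f : X → ℝ} (hf : LipschitzWith 1 f) (S : Set X) :
    volume (f '' S) ≤ μH[1] S := by
  rw [← hausdorffMeasure_real]
  simpa using hf.hausdorffMeasure_image_le (d := 1) zero_le_one S

theorem ofReal_dist_le_hausdorffMeasure {X : Type*} [MetricSpace X] [MeasurableSpace X]
    [BorelSpace X] {Γ : Set X} (hc : IsPreconnected Γ) {v z : X} (hv : v ∈ Γ) (hz : z ∈ Γ) :
    ENNReal.ofReal (dist z v) ≤ μH[1] Γ :=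
  (ofReal_le_volume_image_dist hc hv hz le_rfl).trans <|
    (volume_image_le_hausdorffMeasure (LipschitzWith.dist_left v) _).trans
      (measure_mono inter_subset_left)

theorem card_mul_le_hausdorffMeasure {X : Type*} [MetricSpace X] [MeasurableSpace X]
    [BorelSpace X] {Γ : Set X} (hc : IsPreconnected Γ) {ε : ℝ} (V : Finset X)
    (hV : ∀ v ∈ V, v ∈ Γ) (hsep : ∀ v ∈ V, ∀ w ∈ V, v ≠ w → ε ≤ dist v w)
    (hfar : ∀ v ∈ Γ, ∃ z ∈ Γ, ε / 2 ≤ dist z v) :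
    V.card * ENNReal.ofReal (ε / 2) ≤ μH[1] Γ := by
  have hdisj : (V : Set X).PairwiseDisjoint (fun v => ball v (ε / 2)) := by
    intro v hv w hw hvw
    exact ball_disjoint_ball (by linarith [hsep v hv w hw hvw])
  calc V.card * ENNReal.ofReal (ε / 2) = ∑ v ∈ V, ENNReal.ofReal (ε / 2) := by simp
    _ ≤ ∑ v ∈ V, (μH[1] : Measure X).restrict Γ (ball v (ε / 2)) := by
      refine Finset.sum_le_sum fun v hv => ?_
      obtain ⟨z, hz, hzv⟩ := hfar v (hV v hv)
      rw [Measure.restrict_apply measurableSet_ball, inter_comm]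
      exact (ofReal_le_volume_image_dist hc (hV v hv) hz hzv).trans
        (volume_image_le_hausdorffMeasure (LipschitzWith.dist_left v) _)
    _ = (μH[1] : Measure X).restrict Γ (⋃ v ∈ V, ball v (ε / 2)) :=
      (measure_biUnion_finset hdisj fun _ _ => measurableSet_ball).symm
    _ ≤ (μH[1] : Measure X).restrict Γ univ := measure_mono (subset_univ _)
    _ = _ := by simp

/-- A set of finite length has finite maximal separated subsets. -/
theorem exists_finset_separated_cover {X : Type*} [MetricSpace X] [MeasurableSpace X]
    [BorelSpace X] {Γ : Set X} (hc : IsPreconnected Γ) (hH : μH[1] Γ < ⊤) {ε : ℝ} (hε : 0 < ε)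
    (hfar : ∀ v ∈ Γ, ∃ z ∈ Γ, ε / 2 ≤ dist z v) :
    ∃ V : Finset X, (∀ v ∈ V, v ∈ Γ) ∧ V.card * ε ≤ 2 * (μH[1] Γ).toReal ∧
      ∀ x ∈ Γ, ∃ v ∈ V, dist x v ≤ ε := by
  set P : Finset X → Prop := fun V => (∀ v ∈ V, v ∈ Γ) ∧
    ∀ v ∈ V, ∀ w ∈ V, v ≠ w → ε ≤ dist v w with hP
  have hcard : ∀ V, P V → V.card * ε ≤ 2 * (μH[1] Γ).toReal := by
    intro V hV
    have h := card_mul_le_hausdorffMeasure hc V hV.1 hV.2 hfar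
    have h2 := ENNReal.toReal_mono hH.ne h
    rw [ENNReal.toReal_mul, ENNReal.toReal_ofReal (by positivity)] at h2
    simp at h2
    linarith
  set N : Set ℕ := {n | ∃ V, P V ∧ V.card = n} with hN
  have hne : N.Nonempty := ⟨0, ∅, by simp [hP], rfl⟩
  have hbdd : BddAbove N := by
    obtain ⟨m, hm⟩ := exists_nat_ge (2 * (μH[1] Γ).toReal / ε)
    refine ⟨m, ?_⟩
    rintro n ⟨V, hV, rfl⟩
    have h := hcard V hV
    rw [← le_div_iff₀ hε] at h
    exact_mod_cast h.trans hm
  obtain ⟨V, hV, hVc⟩ := Nat.sSup_mem hne hbdd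
  refine ⟨V, hV.1, hcard V hV, ?_⟩
  by_contra! hcon
  obtain ⟨x, hx, hxV⟩ := hcon
  have hxn : x ∉ V := fun h => by
    have := hxV x h
    rw [dist_self] at this; linarith
  have hP' : P (insert x V) := by
    refine ⟨?_, ?_⟩
    · intro v hv
      rcases Finset.mem_insert.1 hv with rfl | hv
      exacts [hx, hV.1 v hv]
    · intro v hv w hw hvw
      rcases Finset.mem_insert.1 hv with rfl | hv' <;>
        rcases Finset.mem_insert.1 hw with rfl | hw'
      · exact absurd rfl hvw
      · exact (hxV w hw').le
      · rw [dist_comm]; exact (hxV v hv').le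
      · exact hV.2 v hv' w hw' hvw
  have h1 : (insert x V).card ≤ sSup N := le_csSup hbdd ⟨_, hP', rfl⟩
  rw [Finset.card_insert_of_notMem hxn] at h1
  omega

theorem exists_tour_list {X : Type*} [PseudoMetricSpace X] {V : Finset X} {δ : ℝ} {v₀ : X}
    (hv₀ : v₀ ∈ V)
    (hconn : ∀ S ⊆ V, S.Nonempty → S ≠ V → ∃ u ∈ S, ∃ w ∈ V \ S, dist u w ≤ δ) (n : ℕ) :
    ∃ L : List X, L ≠ [] ∧ (∀ v ∈ L, v ∈ V) ∧ L.length ≤ 2 * n + 1 ∧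
      L.IsChain (fun a b => dist a b ≤ δ) ∧ ((∀ v ∈ V, v ∈ L) ∨ n + 1 ≤ L.toFinset.card) := by
  induction n with
  | zero => exact ⟨[v₀], by simp, by simpa using hv₀, by simp, by simp, by simp⟩
  | succ n ih =>
    obtain ⟨L, hL0, hLV, hlen, hch, hcov⟩ := ih
    by_cases hall : ∀ v ∈ V, v ∈ L
    · exact ⟨L, hL0, hLV, by omega, hch, Or.inl hall⟩
    have hcard := hcov.resolve_left hall
    have hsub : L.toFinset ⊆ V := fun v hv => hLV v (List.mem_toFinset.1 hv)
    obtain ⟨u, hu, w, hw, huw⟩ := hconn L.toFinset hsub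
      (by simpa [List.toFinset_nonempty_iff] using hL0)
      (fun h => hall fun v hv => by rw [← h] at hv; exact List.mem_toFinset.1 hv)
    obtain ⟨l₁, l₂, rfl⟩ := List.append_of_mem (List.mem_toFinset.1 hu)
    rw [Finset.mem_sdiff] at hw
    refine ⟨l₁ ++ u :: w :: u :: l₂, by simp, ?_, ?_, ?_, Or.inr ?_⟩
    · intro v hv
      have hu' := hsub hu
      simp only [List.mem_append, List.mem_cons] at hv hLV
      rcases hv with hv | rfl | rfl | rfl | hv
      · exact hLV _ (Or.inl hv)
      · exact hu'
      · exact hw.1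
      · exact hu'
      · exact hLV _ (Or.inr (Or.inr hv))
    · simp at hlen ⊢; omega
    · rw [List.isChain_append] at hch ⊢
      obtain ⟨h1, h2, h3⟩ := hch
      refine ⟨h1, ?_, by simpa using h3⟩
      rw [List.isChain_cons_cons, List.isChain_cons_cons]
      exact ⟨huw, by rwa [dist_comm], h2⟩
    · have : insert w (l₁ ++ u :: l₂).toFinset ⊆ (l₁ ++ u :: w :: u :: l₂).toFinset := by
        intro v hv
        simp at hv ⊢
        tauto
      have h2 := Finset.card_le_card this
      rw [Finset.card_insert_of_notMem hw.2] at h2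
      omega

theorem dist_le_mul_of_forall_succ {X : Type*} [PseudoMetricSpace X] {g : ℕ → X} {δ : ℝ}
    (hg : ∀ i, dist (g i) (g (i + 1)) ≤ δ) (i j : ℕ) : dist (g i) (g j) ≤ δ * |(i : ℝ) - j| := by
  have key : ∀ i n : ℕ, dist (g i) (g (i + n)) ≤ δ * n := by
    intro i n
    induction n with
    | zero => simp
    | succ n ih =>
      have h1 := dist_triangle (g i) (g (i + n)) (g (i + (n + 1)))
      have h2 := hg (i + n)
      rw [add_assoc] at h2
      push_cast; linarith
  rcases le_total i j with h | h
  · obtain ⟨n, rfl⟩ := Nat.exists_eq_add_of_le h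
    simpa using key i n
  · obtain ⟨n, rfl⟩ := Nat.exists_eq_add_of_le h
    rw [dist_comm]
    simpa using key j n

theorem exists_tour {X : Type*} [PseudoMetricSpace X] {V : Finset X} {δ : ℝ} (hδ : 0 ≤ δ)
    (hV : V.Nonempty)
    (hconn : ∀ S ⊆ V, S.Nonempty → S ≠ V → ∃ u ∈ S, ∃ w ∈ V \ S, dist u w ≤ δ) :
    ∃ g : ℕ → X, (∀ i, g i ∈ V) ∧ (∀ i, dist (g i) (g (i + 1)) ≤ δ) ∧
      ∀ v ∈ V, ∃ i ≤ 2 * V.card, g i = v := by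
  obtain ⟨v₀, hv₀⟩ := hV
  obtain ⟨L, hL0, hLV, hlen, hch, hcov⟩ := exists_tour_list hv₀ hconn V.card
  have hall : ∀ v ∈ V, v ∈ L := by
    refine hcov.resolve_right fun h => ?_
    have : L.toFinset ⊆ V := fun v hv => hLV v (List.mem_toFinset.1 hv)
    have := Finset.card_le_card this
    omega
  have hpos : 0 < L.length := List.length_pos_iff.2 hL0
  refine ⟨fun i => L[min i (L.length - 1)]'(by omega), fun i => hLV _ (List.getElem_mem _), ?_, ?_⟩
  · intro i
    by_cases hi : i + 1 ≤ L.length - 1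
    · have h := List.isChain_iff_getElem.1 hch i (by omega)
      have e1 : min i (L.length - 1) = i := by omega
      have e2 : min (i + 1) (L.length - 1) = i + 1 := by omega
      simpa only [e1, e2] using h
    · have e1 : min i (L.length - 1) = L.length - 1 := by omega
      have e2 : min (i + 1) (L.length - 1) = L.length - 1 := by omega
      simp only [e1, e2, dist_self]
      exact hδ
  · intro v hv
    obtain ⟨i, hi, rfl⟩ := List.getElem_of_mem (hall v hv)
    refine ⟨i, by omega, ?_⟩
    have e1 : min i (L.length - 1) = i := by omega
    simp only [e1]

theorem exists_finset_edge {X : Type*} [PseudoMetricSpace X] {Γ : Set X} (hc : IsPreconnected Γ)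
    {V : Finset X} (hVΓ : ∀ v ∈ V, v ∈ Γ) {ε : ℝ} (hε : 0 ≤ ε)
    (hcov : ∀ x ∈ Γ, ∃ v ∈ V, dist x v ≤ ε)
    (S : Finset X) (hS : S ⊆ V) (hne : S.Nonempty) (hSV : S ≠ V) :
    ∃ u ∈ S, ∃ w ∈ V \ S, dist u w ≤ 2 * ε := by
  have hne2 : (V \ S).Nonempty := by
    rw [Finset.sdiff_nonempty]
    exact fun h => hSV (hS.antisymm h)
  have hcl : ∀ F : Finset X, IsClosed (⋃ v ∈ F, closedBall v ε) := fun F =>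
    F.finite_toSet.isClosed_biUnion fun _ _ => isClosed_closedBall
  have h := isPreconnected_closed_iff.1 hc _ _ (hcl S) (hcl (V \ S)) ?_ ?_ ?_
  · obtain ⟨x, -, hx1, hx2⟩ := h
    simp only [mem_iUnion, mem_closedBall] at hx1 hx2
    obtain ⟨u, hu, hxu⟩ := hx1
    obtain ⟨w, hw, hxw⟩ := hx2
    refine ⟨u, hu, w, hw, ?_⟩
    linarith [dist_triangle_left u w x]
  · intro x hx
    obtain ⟨v, hv, hxv⟩ := hcov x hx
    by_cases hvS : v ∈ S
    · left; simp only [mem_iUnion]; exact ⟨v, hvS, hxv⟩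
    · right; simp only [mem_iUnion]; exact ⟨v, Finset.mem_sdiff.2 ⟨hv, hvS⟩, hxv⟩
  · obtain ⟨v, hv⟩ := hne
    exact ⟨v, hVΓ v (hS hv), by simp only [mem_iUnion]; exact ⟨v, hv, mem_closedBall_self hε⟩⟩
  · obtain ⟨v, hv⟩ := hne2
    exact ⟨v, hVΓ v (Finset.mem_sdiff.1 hv).1,
      by simp only [mem_iUnion]; exact ⟨v, hv, mem_closedBall_self hε⟩⟩

theorem exists_coarse_parametrization {X : Type*} [MetricSpace X] [MeasurableSpace X]
    [BorelSpace X] {Γ : Set X} (hc : IsConnected Γ) (hH : μH[1] Γ < ⊤) {ε : ℝ} (hε : 0 < ε)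
    (hfar : ∀ v ∈ Γ, ∃ z ∈ Γ, ε / 2 ≤ dist z v) :
    ∃ f : ℝ → X, (∀ t, f t ∈ Γ) ∧
      (∀ s t, dist (f s) (f t) ≤ (8 * (μH[1] Γ).toReal + 2 * ε) * |s - t| + 2 * ε) ∧
      ∀ x ∈ Γ, ∃ t ∈ Icc (0 : ℝ) 1, dist (f t) x ≤ ε := by
  obtain ⟨V, hVΓ, hcard, hcov⟩ := exists_finset_separated_cover hc.isPreconnected hH hε hfar
  have hVne : V.Nonempty := by
    obtain ⟨x, hx⟩ := hc.nonempty
    obtain ⟨v, hv, -⟩ := hcov x hx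
    exact ⟨v, hv⟩
  obtain ⟨g, hgV, hg, hgs⟩ := exists_tour (δ := 2 * ε) (by positivity) hVne
    (exists_finset_edge hc.isPreconnected hVΓ hε.le hcov)
  set m : ℝ := 2 * V.card + 1 with hm
  have hm0 : 0 < m := by positivity
  refine ⟨fun t => g ⌊t * m⌋₊, fun t => hVΓ _ (hgV _), ?_, ?_⟩
  · intro s t
    refine (dist_le_mul_of_forall_succ hg _ _).trans ?_
    have key : ∀ a b : ℝ, (⌊a⌋₊ : ℝ) - ⌊b⌋₊ ≤ |a - b| + 1 := by
      intro a b
      have h2 := Nat.lt_floor_add_one b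
      rcases le_total 0 a with ha | ha
      · have h1 := Nat.floor_le ha
        have := le_abs_self (a - b)
        linarith
      · rw [Nat.floor_of_nonpos ha]
        have : (0 : ℝ) ≤ ⌊b⌋₊ := by positivity
        have := abs_nonneg (a - b)
        push_cast; linarith
    have h1 : |(⌊s * m⌋₊ : ℝ) - ⌊t * m⌋₊| ≤ |s - t| * m + 1 := by
      rw [abs_le']
      have e : |s * m - t * m| = |s - t| * m := by
        rw [← sub_mul, abs_mul, abs_of_pos hm0]
      have e2 : |t * m - s * m| = |s - t| * m := by rw [abs_sub_comm, e]
      have := key (s * m) (t * m)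
      have := key (t * m) (s * m)
      constructor <;> linarith
    calc 2 * ε * _ ≤ 2 * ε * (|s - t| * m + 1) := by gcongr
      _ = (4 * (V.card * ε) + 2 * ε) * |s - t| + 2 * ε := by rw [hm]; ring
      _ ≤ (4 * (2 * (μH[1] Γ).toReal) + 2 * ε) * |s - t| + 2 * ε := by gcongr
      _ = _ := by ring
  · intro x hx
    obtain ⟨v, hv, hxv⟩ := hcov x hx
    obtain ⟨i, hi, rfl⟩ := hgs v hv
    refine ⟨i / m, ⟨by positivity, ?_⟩, ?_⟩
    · rw [div_le_one hm0, hm]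
      have : (i : ℝ) ≤ 2 * V.card := by exact_mod_cast hi
      linarith
    · simp only [div_mul_cancel₀ _ hm0.ne', Nat.floor_natCast]
      rwa [dist_comm]

open Filter Topology in
/-- A compact connected set of finite length is a Lipschitz image of the unit interval. -/
theorem exists_lipschitz_parametrization {X : Type*} [MetricSpace X] [MeasurableSpace X]
    [BorelSpace X] {Γ : Set X} (hcpt : IsCompact Γ) (hc : IsConnected Γ) (hH : μH[1] Γ < ⊤)
    {a b : X} (ha : a ∈ Γ) (hb : b ∈ Γ) (hab : a ≠ b) :
    ∃ γ : ℝ → X, (∀ s t, dist (γ s) (γ t) ≤ 8 * (μH[1] Γ).toReal * |s - t|) ∧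
      (∀ t, γ t ∈ Γ) ∧ Γ = γ '' Icc 0 1 := by
  set d := dist a b with hd
  have hd0 : 0 < d := dist_pos.2 hab
  set ε : ℕ → ℝ := fun n => d / (n + 1) with hε
  have hε0 : ∀ n, 0 < ε n := fun n => by positivity
  have hεd : ∀ n, ε n ≤ d := fun n => div_le_self hd0.le (by simp)
  have hεt : Tendsto ε atTop (𝓝 0) := by
    have := (tendsto_one_div_add_atTop_nhds_zero_nat (𝕜 := ℝ)).const_mul d
    simpa [hε, div_eq_mul_inv] using this
  have hfar : ∀ n, ∀ v ∈ Γ, ∃ z ∈ Γ, ε n / 2 ≤ dist z v := by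
    intro n v hv
    by_contra! hcon
    have h1 := hcon a ha
    have h2 := hcon b hb
    have := dist_triangle_right a b v
    linarith [hεd n]
  choose f hfΓ hfl hfs using fun n => exists_coarse_parametrization hc hH (hε0 n) (hfar n)
  set U : Ultrafilter ℕ := hyperfilter ℕ with hU
  have hUle : (U : Filter ℕ) ≤ atTop := by
    rw [← Nat.cofinite_eq_atTop]; exact hyperfilter_le_cofinite
  have hεU : Tendsto ε U (𝓝 0) := hεt.mono_left hUle
  have hlim : ∀ t, ∃ x ∈ Γ, Tendsto (fun n => f n t) U (𝓝 x) := by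
    intro t
    obtain ⟨x, hx, hle⟩ := hcpt.ultrafilter_le_nhds (U.map fun n => f n t)
      (by rw [le_principal_iff]; exact Filter.mem_map.2 (univ_mem' fun n => hfΓ n t))
    exact ⟨x, hx, hle⟩
  choose γ hγΓ hγ using hlim
  set H := (μH[1] Γ).toReal
  refine ⟨γ, ?_, hγΓ, ?_⟩
  · intro s t
    have h1 : Tendsto (fun n => dist (f n s) (f n t)) U (𝓝 (dist (γ s) (γ t))) :=
      (hγ s).dist (hγ t)
    have h2 : Tendsto (fun n => (8 * H + 2 * ε n) * |s - t| + 2 * ε n) U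
        (𝓝 ((8 * H + 2 * 0) * |s - t| + 2 * 0)) :=
      (((hεU.const_mul 2).const_add _).mul_const _).add (hεU.const_mul 2)
    have := le_of_tendsto_of_tendsto' h1 h2 fun n => hfl n s t
    simpa using this
  · refine Subset.antisymm ?_ (by rintro _ ⟨t, -, rfl⟩; exact hγΓ t)
    intro x hx
    choose t ht htx using fun n => hfs n x hx
    obtain ⟨t', ht', hle⟩ := isCompact_Icc.ultrafilter_le_nhds (U.map t)
      (by rw [le_principal_iff]; exact Filter.mem_map.2 (univ_mem' ht))
    have htt : Tendsto t U (𝓝 t') := hle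
    refine ⟨t', ht', ?_⟩
    have h1 : Tendsto (fun n => dist (f n t') x) U (𝓝 (dist (γ t') x)) :=
      (hγ t').dist tendsto_const_nhds
    have h2 : Tendsto (fun n => (8 * H + 2 * ε n) * |t' - t n| + 2 * ε n + ε n) U
        (𝓝 ((8 * H + 2 * 0) * |t' - t'| + 2 * 0 + 0)) :=
      ((((hεU.const_mul 2).const_add _).mul (tendsto_const_nhds.sub htt).abs).add
        (hεU.const_mul 2)).add hεU
    have h3 := le_of_tendsto_of_tendsto' h1 h2 fun n => by
      have := dist_triangle (f n t') (f n (t n)) x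
      linarith [hfl n t' (t n), htx n]
    have h4 : dist (γ t') x ≤ 0 := by simpa using h3
    exact dist_le_zero.1 h4

/-- The length of `γ` between `s` and `t`, measured with partition points in `D` only. -/
def arcLen {X : Type*} [PseudoMetricSpace X] (γ : ℝ → X) (D : Set ℝ) (s t : ℝ) : ℝ :=
  (eVariationOn γ (D ∩ Icc s t)).toReal

section ArcLen

variable {X : Type*} [PseudoMetricSpace X] {γ : ℝ → X} {L : ℝ≥0} {D D' : Set ℝ} {s t u : ℝ}

theorem arcLen_nonneg : 0 ≤ arcLen γ D s t := ENNReal.toReal_nonneg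

theorem eVariationOn_le_of_lipschitz (hγ : LipschitzWith L γ) :
    eVariationOn γ (D ∩ Icc s t) ≤ L * ENNReal.ofReal (t - s) := by
  refine (eVariationOn.mono γ (inter_subset_right)).trans ?_
  have h := (hγ.lipschitzOnWith (s := univ)).comp_eVariationOn_le (f := γ) (g := id)
    (s := Icc s t) (mapsTo_univ _ _)
  have h2 : eVariationOn (id : ℝ → ℝ) (Icc s t) = ENNReal.ofReal (t - s) :=
    eVariationOn_id_Icc s t
  rw [h2] at h
  simpa using h

theorem eVariationOn_ne_top_of_lipschitz (hγ : LipschitzWith L γ) :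
    eVariationOn γ (D ∩ Icc s t) ≠ ⊤ :=
  ((eVariationOn_le_of_lipschitz hγ).trans_lt
    (ENNReal.mul_lt_top ENNReal.coe_lt_top ENNReal.ofReal_lt_top)).ne

theorem arcLen_le (hγ : LipschitzWith L γ) (hst : s ≤ t) : arcLen γ D s t ≤ L * (t - s) := by
  have h := ENNReal.toReal_mono (ENNReal.mul_lt_top ENNReal.coe_lt_top ENNReal.ofReal_lt_top).ne
    (eVariationOn_le_of_lipschitz (D := D) (s := s) (t := t) hγ)
  rwa [ENNReal.toReal_mul, ENNReal.toReal_ofReal (by linarith)] at h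

theorem arcLen_add (hγ : LipschitzWith L γ) (hst : s ≤ t) (htu : t ≤ u) (ht : t ∈ D) :
    arcLen γ D s t + arcLen γ D t u = arcLen γ D s u := by
  rw [arcLen, arcLen, arcLen, ← eVariationOn.Icc_add_Icc γ hst htu ht,
    ENNReal.toReal_add (eVariationOn_ne_top_of_lipschitz hγ)
      (eVariationOn_ne_top_of_lipschitz hγ)]

theorem dist_le_arcLen (hγ : LipschitzWith L γ) (hst : s ≤ t) (hs : s ∈ D) (ht : t ∈ D) :
    dist (γ s) (γ t) ≤ arcLen γ D s t := by
  have h := eVariationOn.edist_le γ (s := D ∩ Icc s t) ⟨hs, left_mem_Icc.2 hst⟩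
    ⟨ht, right_mem_Icc.2 hst⟩
  have h2 := ENNReal.toReal_mono (eVariationOn_ne_top_of_lipschitz hγ) h
  rwa [edist_dist, ENNReal.toReal_ofReal dist_nonneg] at h2

theorem arcLen_mono (hγ : LipschitzWith L γ) (hD : D ∩ Icc s t ⊆ D' ∩ Icc s t) :
    arcLen γ D s t ≤ arcLen γ D' s t :=
  ENNReal.toReal_mono (eVariationOn_ne_top_of_lipschitz hγ) (eVariationOn.mono γ hD)

theorem arcLen_congr (hD : D ∩ Icc s t = D' ∩ Icc s t) : arcLen γ D s t = arcLen γ D' s t := by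
  rw [arcLen, arcLen, hD]

theorem arcLen_of_disjoint (hst : s ≤ t) (hs : s ∈ D) (ht : t ∈ D) (hD : Disjoint (Ioo s t) D) :
    arcLen γ D s t = dist (γ s) (γ t) := by
  have : D ∩ Icc s t = {s, t} := by
    ext x
    constructor
    · rintro ⟨hx, hsx, hxt⟩
      rcases hsx.eq_or_lt with rfl | h1
      · simp
      rcases hxt.eq_or_lt with rfl | h2
      · simp
      exact absurd hx (disjoint_left.1 hD ⟨h1, h2⟩)
    · rintro (rfl | rfl)
      exacts [⟨hs, left_mem_Icc.2 hst⟩, ⟨ht, right_mem_Icc.2 hst⟩]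
  rw [arcLen, this, eVariationOn.pair, edist_dist, ENNReal.toReal_ofReal dist_nonneg]

end ArcLen

/-- Parameter intervals not meeting `D` have images of size at most `ε`. -/
def HasMesh {X : Type*} [PseudoMetricSpace X] (γ : ℝ → X) (D : Set ℝ) (ε : ℝ) : Prop :=
  ∀ u v, 0 ≤ u → u ≤ v → v ≤ 1 → Disjoint (Ioo u v) D → dist (γ u) (γ v) ≤ ε

theorem HasMesh.dist_le_of_floor {X : Type*} [PseudoMetricSpace X] {γ : ℝ → X} {D : Set ℝ}
    {ε : ℝ} (hε : HasMesh γ D ε) (hD : IsClosed D) {s a : ℝ} (ha : a ∈ D) (ha0 : 0 ≤ a)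
    (has : a ≤ s) (hs1 : s ≤ 1) :
    ∃ u ∈ D, a ≤ u ∧ u ≤ s ∧ dist (γ u) (γ s) ≤ ε := by
  have hcpt : IsCompact (D ∩ Icc a s) := isCompact_Icc.inter_left hD
  have hm := hcpt.sSup_mem ⟨a, ha, left_mem_Icc.2 has⟩
  refine ⟨_, hm.1, hm.2.1, hm.2.2, hε _ _ (ha0.trans hm.2.1) hm.2.2 hs1 ?_⟩
  rw [disjoint_left]
  intro t ht htD
  have := le_csSup hcpt.bddAbove ⟨htD, (hm.2.1.trans ht.1.le), ht.2.le⟩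
  exact absurd ht.1 (not_lt.2 this)

/-- A chain of parameters in `D` with steps of size about `r`. -/
structure IsStepChain {X : Type*} [PseudoMetricSpace X] (γ : ℝ → X) (D : Set ℝ) (r R : ℝ)
    (σ : ℕ → ℝ) (n : ℕ) : Prop where
  mono : Monotone σ
  mem : ∀ i, σ i ∈ D
  zero : σ 0 = 0
  last : σ n = 1
  dist_le : ∀ i, ∀ s ∈ Icc (σ i) (σ (i + 1)), dist (γ (σ i)) (γ s) ≤ R
  le_dist : ∀ i, i + 1 < n → r ≤ dist (γ (σ i)) (γ (σ (i + 1)))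

theorem exists_next_step {X : Type*} [PseudoMetricSpace X] {γ : ℝ → X} {L : ℝ≥0}
    (hγ : LipschitzWith L γ) {D : Set ℝ} (hD : IsClosed D) (hD01 : D ⊆ Icc 0 1)
    (h1 : (1 : ℝ) ∈ D) {ε r : ℝ} (hε : HasMesh γ D ε) {s : ℝ} (hs : s ∈ D) :
    ∃ t ∈ D, s ≤ t ∧ (∀ x ∈ Icc s t, dist (γ s) (γ x) ≤ max 0 (r + ε)) ∧
      (t ≠ 1 → r ≤ dist (γ s) (γ t)) := by
  have hcont := hγ.continuous
  set F : Set ℝ := D ∩ Icc s 1 ∩ {t | r ≤ dist (γ s) (γ t)} with hF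
  have hFc : IsCompact F := by
    refine (isCompact_Icc.inter_left hD).inter_right ?_
    exact isClosed_le continuous_const (continuous_const.dist hcont)
  obtain ⟨t, ht, hst, ht1, htF, htr⟩ : ∃ t ∈ D, s ≤ t ∧ t ≤ 1 ∧
      (∀ x ∈ D, s ≤ x → x < t → dist (γ s) (γ x) < r) ∧ (t ≠ 1 → r ≤ dist (γ s) (γ t)) := by
    rcases F.eq_empty_or_nonempty with h | h
    · refine ⟨1, h1, (hD01 hs).2, le_rfl, fun x hx hsx hx1 => ?_, fun h => absurd rfl h⟩
      by_contra! hcon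
      exact (h ▸ (⟨⟨hx, hsx, hx1.le⟩, hcon⟩ : x ∈ F) : x ∈ (∅ : Set ℝ))
    · have hm := hFc.sInf_mem h
      refine ⟨_, hm.1.1, hm.1.2.1, hm.1.2.2, fun x hx hsx hx1 => ?_, fun _ => hm.2⟩
      by_contra! hcon
      exact absurd hx1 (not_lt.2 (csInf_le hFc.bddBelow
        ⟨⟨hx, hsx, hx1.le.trans hm.1.2.2⟩, hcon⟩))
  refine ⟨t, ht, hst, ?_, htr⟩
  rcases hst.eq_or_lt with rfl | hlt
  · intro x hx
    rw [Icc_self, mem_singleton_iff] at hx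
    subst hx; simp
  · have hcl : IsClosed {x | dist (γ s) (γ x) ≤ max 0 (r + ε)} :=
      isClosed_le (continuous_const.dist hcont) continuous_const
    have hsub : Ico s t ⊆ {x | dist (γ s) (γ x) ≤ max 0 (r + ε)} := by
      intro x hx
      obtain ⟨u, hu, hsu, hux, hd⟩ := hε.dist_le_of_floor hD hs (hD01 hs).1 hx.1
        (hx.2.le.trans ht1)
      have h2 := htF u hu hsu (hux.trans_lt hx.2)
      have := dist_triangle (γ s) (γ u) (γ x)
      have h3 : dist (γ s) (γ x) ≤ r + ε := by linarith
      exact h3.trans (le_max_right _ _)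
    have := hcl.closure_subset_iff.2 hsub
    rwa [closure_Ico hlt.ne] at this

theorem exists_isStepChain {X : Type*} [PseudoMetricSpace X] {γ : ℝ → X} {L : ℝ≥0}
    (hγ : LipschitzWith L γ) {D : Set ℝ} (hD : IsClosed D) (hD01 : D ⊆ Icc 0 1)
    (h0 : (0 : ℝ) ∈ D) (h1 : (1 : ℝ) ∈ D) {ε r : ℝ} (hε0 : 0 ≤ ε) (hr : 0 < r)
    (hε : HasMesh γ D ε) :
    ∃ σ n, IsStepChain γ D r (r + ε) σ n := by
  have hnext : ∀ s : D, ∃ t : D, s.1 ≤ t.1 ∧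
      (∀ x ∈ Icc s.1 t.1, dist (γ s) (γ x) ≤ r + ε) ∧ (t.1 ≠ 1 → r ≤ dist (γ s) (γ t)) := by
    rintro ⟨s, hs⟩
    obtain ⟨t, ht, h⟩ := exists_next_step hγ hD hD01 h1 hε (r := r) hs
    rw [max_eq_right (by positivity)] at h
    exact ⟨⟨t, ht⟩, h⟩
  choose f hf using hnext
  set σ : ℕ → D := fun i => f^[i] ⟨0, h0⟩ with hσ
  have hsucc : ∀ i, σ (i + 1) = f (σ i) := fun i => Function.iterate_succ_apply' f i _
  have hmono : Monotone fun i => (σ i).1 := monotone_nat_of_le_succ fun i => by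
    rw [hsucc]; exact (hf (σ i)).1
  have hex : ∃ n, (σ n).1 = 1 := by
    by_contra! hcon
    have hgrow : ∀ i : ℕ, i * r ≤ L * (σ i).1 := by
      intro i
      induction i with
      | zero => simp [hσ]
      | succ i ih =>
        have h2 := (hf (σ i)).2.2 (by rw [← hsucc]; exact hcon _)
        have h3 := hγ.dist_le_mul (σ i).1 (f (σ i)).1
        rw [dist_comm (σ i).1, Real.dist_eq, abs_of_nonneg (by linarith [(hf (σ i)).1])] at h3
        rw [hsucc]
        push_cast
        linarith
    obtain ⟨m, hm⟩ := exists_nat_gt (L / r : ℝ)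
    rw [div_lt_iff₀ hr] at hm
    have h4 := hgrow m
    have h5 : (L : ℝ) * (σ m).1 ≤ L * 1 := by
      gcongr; exact (hD01 (σ m).2).2
    linarith
  refine ⟨fun i => (σ i).1, Nat.find hex, hmono, fun i => (σ i).2, rfl, Nat.find_spec hex, ?_, ?_⟩
  · intro i s hs
    rw [hsucc] at hs
    exact (hf (σ i)).2.1 s hs
  · intro i hi
    have := Nat.find_min hex hi
    rw [hsucc] at this ⊢
    exact (hf (σ i)).2.2 this

theorem IsStepChain.exists_mem_Icc {X : Type*} [PseudoMetricSpace X] {γ : ℝ → X} {D : Set ℝ}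
    {r R : ℝ} {σ : ℕ → ℝ} {n : ℕ} (h : IsStepChain γ D r R σ n) {t : ℝ} (ht : t ∈ Icc (0 : ℝ) 1) :
    ∃ i < n, t ∈ Icc (σ i) (σ (i + 1)) := by
  have hn : n ≠ 0 := by
    rintro rfl
    have := h.zero.symm.trans h.last
    norm_num at this
  have hex : ∃ j, t ≤ σ (j + 1) := ⟨n - 1, by
    rw [Nat.sub_add_cancel (by omega), h.last]; exact ht.2⟩
  refine ⟨Nat.find hex, ?_, ?_, Nat.find_spec hex⟩
  · have : Nat.find hex ≤ n - 1 := Nat.find_min' hex (by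
      rw [Nat.sub_add_cancel (by omega), h.last]; exact ht.2)
    omega
  · rcases hj : Nat.find hex with _ | j
    · rw [h.zero]; exact ht.1
    · have := Nat.find_min hex (m := j) (by omega)
      exact (not_le.1 this).le

theorem IsStepChain.dist_le_mul {X : Type*} [PseudoMetricSpace X] {γ : ℝ → X} {D : Set ℝ}
    {r R : ℝ} {σ : ℕ → ℝ} {n : ℕ} (h : IsStepChain γ D r R σ n) (i m : ℕ) {t : ℝ}
    (ht : t ∈ Icc (σ i) (σ (i + m))) : dist (γ (σ i)) (γ t) ≤ m * R := by
  have hR : 0 ≤ R := dist_nonneg.trans (h.dist_le i _ (left_mem_Icc.2 (h.mono i.le_succ)))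
  induction m generalizing t with
  | zero =>
    have : t = σ i := by simpa using ht
    simp [this]
  | succ m ih =>
    rcases le_total t (σ (i + m)) with hle | hle
    · have := ih ⟨ht.1, hle⟩
      push_cast; linarith
    · have h0 : σ (i + m) ∈ Icc (σ i) (σ (i + m)) := ⟨h.mono (by omega), le_rfl⟩
      have h1 : dist (γ (σ i)) (γ (σ (i + m))) ≤ m * R := ih h0
      have h2 := h.dist_le (i + m) t ⟨hle, ht.2⟩
      have h3 := dist_triangle (γ (σ i)) (γ (σ (i + m))) (γ t)
      push_cast; linarith

theorem IsStepChain.mul_le_arcLen {X : Type*} [PseudoMetricSpace X] {γ : ℝ → X} {D : Set ℝ}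
    {L : ℝ≥0} (hγ : LipschitzWith L γ)
    {r R : ℝ} {σ : ℕ → ℝ} {n : ℕ} (h : IsStepChain γ D r R σ n) (i m : ℕ) (him : i + m < n) :
    m * r ≤ arcLen γ D (σ i) (σ (i + m)) := by
  induction m with
  | zero => simpa using arcLen_nonneg
  | succ m ih =>
    have h1 := ih (by omega)
    have h2 := h.le_dist (i + m) (by omega)
    have h3 := dist_le_arcLen hγ (h.mono (i + m).le_succ) (h.mem _) (h.mem (i + m + 1))
    have h4 := arcLen_add hγ (h.mono (show i ≤ i + m by omega)) (h.mono (i + m).le_succ)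
      (h.mem (i + m))
    rw [show i + (m + 1) = (i + m).succ by omega, ← h4]
    push_cast
    linarith

theorem IsStepChain.lt_of_lt {X : Type*} [PseudoMetricSpace X] {γ : ℝ → X} {D : Set ℝ}
    {r R : ℝ} (hr : 0 < r) {σ : ℕ → ℝ} {n : ℕ} (h : IsStepChain γ D r R σ n) {i j : ℕ}
    (hij : i < j) (hj : j < n) : σ i < σ j := by
  have h1 : σ i < σ (i + 1) := by
    refine lt_of_le_of_ne (h.mono i.le_succ) fun heq => ?_
    have := h.le_dist i (by omega)
    rw [heq, dist_self] at this
    linarith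
  exact h1.trans_le (h.mono hij)

/-- What remains of the unit interval after removing a finite family of open gaps. -/
def gapCompl (G : Finset (ℝ × ℝ)) : Set ℝ := Icc 0 1 \ ⋃ g ∈ G, Ioo g.1 g.2

/-- A finite family of disjoint gaps in the unit interval. -/
structure IsGapFamily (G : Finset (ℝ × ℝ)) : Prop where
  nonneg : ∀ g ∈ G, 0 ≤ g.1
  lt : ∀ g ∈ G, g.1 < g.2
  le_one : ∀ g ∈ G, g.2 ≤ 1
  disj : ∀ g ∈ G, ∀ h ∈ G, g ≠ h → Disjoint (Ioo g.1 g.2) (Ioo h.1 h.2)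

theorem mem_gapCompl {G : Finset (ℝ × ℝ)} {s : ℝ} :
    s ∈ gapCompl G ↔ s ∈ Icc (0 : ℝ) 1 ∧ ∀ g ∈ G, s ∉ Ioo g.1 g.2 := by
  simp only [gapCompl, mem_sdiff, mem_iUnion, not_exists]

theorem isClosed_gapCompl (G : Finset (ℝ × ℝ)) : IsClosed (gapCompl G) :=
  isClosed_Icc.sdiff (isOpen_biUnion fun _ _ => isOpen_Ioo)

theorem gapCompl_subset (G : Finset (ℝ × ℝ)) : gapCompl G ⊆ Icc 0 1 := sdiff_subset

theorem IsGapFamily.zero_mem {G : Finset (ℝ × ℝ)} (hG : IsGapFamily G) : (0 : ℝ) ∈ gapCompl G :=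
  mem_gapCompl.2 ⟨by simp, fun g hg h => absurd h.1 (not_lt.2 (hG.nonneg g hg))⟩

theorem IsGapFamily.one_mem {G : Finset (ℝ × ℝ)} (hG : IsGapFamily G) : (1 : ℝ) ∈ gapCompl G :=
  mem_gapCompl.2 ⟨by simp, fun g hg h => absurd h.2 (not_lt.2 (hG.le_one g hg))⟩

theorem not_mem_Ioo_of_disjoint {a b c d : ℝ} (hab : a < b)
    (h : Disjoint (Ioo a b) (Ioo c d)) : a ∉ Ioo c d ∧ b ∉ Ioo c d := by
  rw [disjoint_left] at h
  refine ⟨fun hm => ?_, fun hm => ?_⟩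
  · obtain ⟨x, hx1, hx2⟩ := exists_between (lt_min hab hm.2)
    exact h ⟨hx1, hx2.trans_le (min_le_left _ _)⟩ ⟨hm.1.trans hx1, hx2.trans_le (min_le_right _ _)⟩
  · obtain ⟨x, hx1, hx2⟩ := exists_between (max_lt hab hm.1)
    exact h ⟨(le_max_left _ _).trans_lt hx1, hx2⟩ ⟨(le_max_right _ _).trans_lt hx1, hx2.trans hm.2⟩

theorem IsGapFamily.mem_gapCompl {G : Finset (ℝ × ℝ)} (hG : IsGapFamily G) {g : ℝ × ℝ}
    (hg : g ∈ G) : g.1 ∈ gapCompl G ∧ g.2 ∈ gapCompl G := by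
  have h1 := hG.nonneg g hg
  have h2 := hG.lt g hg
  have h3 := hG.le_one g hg
  have key : ∀ h ∈ G, g.1 ∉ Ioo h.1 h.2 ∧ g.2 ∉ Ioo h.1 h.2 := by
    intro h hh
    by_cases heq : g = h
    · subst heq; simp
    · exact not_mem_Ioo_of_disjoint h2 (hG.disj g hg h hh heq)
  exact ⟨_root_.mem_gapCompl.2 ⟨⟨h1, by linarith⟩, fun h hh => (key h hh).1⟩,
    _root_.mem_gapCompl.2 ⟨⟨by linarith, h3⟩, fun h hh => (key h hh).2⟩⟩

theorem Ioo_subset_of_mem_gapCompl {G : Finset (ℝ × ℝ)} {a b s : ℝ} (ha : a ∈ gapCompl G)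
    (hb : b ∈ gapCompl G) {g : ℝ × ℝ} (hg : g ∈ G) (hs : s ∈ Ioo g.1 g.2) (hsab : s ∈ Icc a b) :
    a ≤ g.1 ∧ g.2 ≤ b := by
  have h1 := (mem_gapCompl.1 ha).2 g hg
  have h2 := (mem_gapCompl.1 hb).2 g hg
  constructor
  · by_contra! h
    exact h1 ⟨h, hsab.1.trans_lt hs.2⟩
  · by_contra! h
    exact h2 ⟨hs.1.trans_le hsab.2, h⟩

/-- The height of the arc of `γ` over its chord. -/
def arcHeight {X : Type*} [NormedAddCommGroup X] [NormedSpace ℝ X] (γ : ℝ → X) (u v : ℝ) : ℝ :=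
  sSup ((fun s => infDist (γ s) (segment ℝ (γ u) (γ v))) '' Icc u v)

section ArcHeight

variable {X : Type*} [NormedAddCommGroup X] [NormedSpace ℝ X] {γ : ℝ → X} {L : ℝ≥0}

theorem arcHeight_nonneg (u v : ℝ) : 0 ≤ arcHeight γ u v := by
  refine Real.sSup_nonneg ?_
  rintro _ ⟨s, -, rfl⟩
  exact infDist_nonneg

theorem infDist_le_arcHeight (hγ : LipschitzWith L γ) {u v s : ℝ} (hs : s ∈ Icc u v) :
    infDist (γ s) (segment ℝ (γ u) (γ v)) ≤ arcHeight γ u v := by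
  refine le_csSup ?_ (mem_image_of_mem _ hs)
  have hc : Continuous fun s => infDist (γ s) (segment ℝ (γ u) (γ v)) :=
    (continuous_infDist_pt _).comp hγ.continuous
  exact (isCompact_Icc.image hc).bddAbove

theorem arcHeight_le {u v B : ℝ} (huv : u ≤ v)
    (h : ∀ s ∈ Icc u v, infDist (γ s) (segment ℝ (γ u) (γ v)) ≤ B) : arcHeight γ u v ≤ B := by
  refine csSup_le ((nonempty_Icc.2 huv).image _) ?_
  rintro _ ⟨s, hs, rfl⟩
  exact h s hs

theorem infDist_le_of_mem_segment {K : Set X} (hK : Convex ℝ K) (hKn : K.Nonempty) {a b z : X}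
    {δ : ℝ} (ha : infDist a K ≤ δ) (hb : infDist b K ≤ δ) (hz : z ∈ segment ℝ a b) :
    infDist z K ≤ δ := by
  have hδ : 0 ≤ δ := infDist_nonneg.trans ha
  have hmem : ∀ x, x ∈ cthickening δ K ↔ infDist x K ≤ δ := by
    intro x
    rw [mem_cthickening_iff, infDist, ENNReal.le_ofReal_iff_toReal_le (infEDist_ne_top hKn) hδ]
  rw [← hmem] at ha hb ⊢
  exact (hK.cthickening δ).segment_subset ha hb hz

theorem infDist_le_arcHeight_add (hγ : LipschitzWith L γ) {K : Set X} (hK : Convex ℝ K)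
    (hKn : K.Nonempty) {u v s δ : ℝ} (hs : s ∈ Icc u v) (hu : infDist (γ u) K ≤ δ)
    (hv : infDist (γ v) K ≤ δ) : infDist (γ s) K ≤ arcHeight γ u v + δ := by
  refine le_of_forall_pos_lt_add fun ε hε => ?_
  have h := infDist_le_arcHeight hγ hs
  obtain ⟨z, hz, hd⟩ := (infDist_lt_iff ⟨_, left_mem_segment ℝ (γ u) (γ v)⟩).1
    (h.trans_lt (lt_add_of_pos_right _ hε))
  have h1 := infDist_le_of_mem_segment hK hKn hu hv hz
  have h2 := infDist_le_infDist_add_dist (s := K) (x := γ s) (y := z)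
  linarith

theorem arcHeight_rpow_le {p c : ℝ} (hp : 2 ≤ p) (hc : 0 < c) (hX : HasExcessBound X p c)
    (hγ : LipschitzWith L γ) {G : Finset (ℝ × ℝ)} (hG : IsGapFamily G) {a b R : ℝ} (hab : a ≤ b)
    (ha : a ∈ gapCompl G) (hb : b ∈ gapCompl G)
    (hR : ∀ t ∈ Icc a b, dist (γ a) (γ t) ≤ R) :
    arcHeight γ a b ^ p ≤
      2 ^ (p - 1) * ((∑ g ∈ G with Ioo g.1 g.2 ⊆ Ioo a b, arcHeight γ g.1 g.2 ^ p) +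
        R ^ (p - 1) / c * (arcLen γ (gapCompl G) a b - dist (γ a) (γ b))) := by
  have hp0 : 0 < p := by linarith
  have hR0 : 0 ≤ R := dist_nonneg.trans (hR a (left_mem_Icc.2 hab))
  set E := arcLen γ (gapCompl G) a b - dist (γ a) (γ b) with hE
  have hE0 : 0 ≤ E := sub_nonneg.2 (dist_le_arcLen hγ hab ha hb)
  set e := R ^ (p - 1) / c * E with he
  have he0 : 0 ≤ e := by positivity
  set S := ∑ g ∈ G with Ioo g.1 g.2 ⊆ Ioo a b, arcHeight γ g.1 g.2 ^ p with hS
  have hpos : ∀ g : ℝ × ℝ, 0 ≤ arcHeight γ g.1 g.2 ^ p := fun g =>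
    Real.rpow_nonneg (arcHeight_nonneg _ _) _
  have hS0 : 0 ≤ S := Finset.sum_nonneg fun g _ => hpos g
  have hδ : ∀ s ∈ Icc a b, s ∈ gapCompl G →
      infDist (γ s) (segment ℝ (γ a) (γ b)) ≤ e ^ (1 / p) := by
    intro s hs hsD
    have h1 := hX (γ a) (γ s) (γ b) R ((min_le_left _ _).trans (hR s hs))
    have h2 := dist_le_arcLen hγ hs.1 ha hsD
    have h3 := dist_le_arcLen hγ hs.2 hsD hb
    have h4 := arcLen_add hγ hs.1 hs.2 hsD
    have h5 : infDist (γ s) (segment ℝ (γ a) (γ b)) ^ p ≤ e := by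
      rw [he, div_mul_eq_mul_div, le_div_iff₀ hc, mul_comm]
      refine h1.trans ?_
      gcongr
      linarith
    calc _ = (infDist (γ s) (segment ℝ (γ a) (γ b)) ^ p) ^ (1 / p) := by
          rw [← Real.rpow_mul infDist_nonneg, mul_one_div_cancel hp0.ne', Real.rpow_one]
      _ ≤ _ := Real.rpow_le_rpow (Real.rpow_nonneg infDist_nonneg _) h5 (by positivity)
  have hee : (e ^ (1 / p)) ^ p = e := by
    rw [← Real.rpow_mul he0, one_div_mul_cancel hp0.ne', Real.rpow_one]
  have hseg : (segment ℝ (γ a) (γ b)).Nonempty := ⟨_, left_mem_segment ℝ _ _⟩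
  have hone : (1 : ℝ) ≤ 2 ^ (p - 1) := Real.one_le_rpow (by norm_num) (by linarith)
  set B := 2 ^ (p - 1) * (S + e) with hB
  have hB0 : 0 ≤ B := by positivity
  have key : ∀ s ∈ Icc a b, infDist (γ s) (segment ℝ (γ a) (γ b)) ^ p ≤ B := by
    intro s hs
    by_cases hsD : s ∈ gapCompl G
    · calc _ ≤ (e ^ (1 / p)) ^ p := Real.rpow_le_rpow infDist_nonneg (hδ s hs hsD) hp0.le
        _ = e := hee
        _ ≤ S + e := by linarith
        _ ≤ B := le_mul_of_one_le_left (by positivity) hone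
    · have hs01 : s ∈ Icc (0 : ℝ) 1 :=
        ⟨(gapCompl_subset _ ha).1.trans hs.1, hs.2.trans (gapCompl_subset _ hb).2⟩
      obtain ⟨g, hg, hsg⟩ : ∃ g ∈ G, s ∈ Ioo g.1 g.2 := by
        by_contra! hcon
        exact hsD (mem_gapCompl.2 ⟨hs01, hcon⟩)
      obtain ⟨h1, h2⟩ := Ioo_subset_of_mem_gapCompl ha hb hg hsg hs
      have hlt := hG.lt g hg
      obtain ⟨hm1, hm2⟩ := hG.mem_gapCompl hg
      have h3 := infDist_le_arcHeight_add hγ (convex_segment _ _) hseg ⟨hsg.1.le, hsg.2.le⟩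
        (hδ g.1 ⟨h1, by linarith⟩ hm1) (hδ g.2 ⟨by linarith, h2⟩ hm2)
      have h4 : arcHeight γ g.1 g.2 ^ p ≤ S :=
        Finset.single_le_sum (f := fun g : ℝ × ℝ => arcHeight γ g.1 g.2 ^ p) (fun g _ => hpos g)
          (Finset.mem_filter.2 ⟨hg, Ioo_subset_Ioo h1 h2⟩)
      have h5 : (arcHeight γ g.1 g.2 + e ^ (1 / p)) ^ p ≤
          2 ^ (p - 1) * (arcHeight γ g.1 g.2 ^ p + (e ^ (1 / p)) ^ p) := by
        have := NNReal.rpow_add_le_mul_rpow_add_rpow ⟨_, arcHeight_nonneg (γ := γ) g.1 g.2⟩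
          ⟨e ^ (1 / p), by positivity⟩ (p := p) (by linarith)
        exact_mod_cast this
      rw [hee] at h5
      calc _ ≤ (arcHeight γ g.1 g.2 + e ^ (1 / p)) ^ p :=
            Real.rpow_le_rpow infDist_nonneg h3 hp0.le
        _ ≤ _ := h5
        _ ≤ B := by rw [hB]; gcongr
  have hfin : arcHeight γ a b ≤ B ^ (1 / p) := by
    refine arcHeight_le hab fun s hs => ?_
    calc _ = (infDist (γ s) (segment ℝ (γ a) (γ b)) ^ p) ^ (1 / p) := by
          rw [← Real.rpow_mul infDist_nonneg, mul_one_div_cancel hp0.ne', Real.rpow_one]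
      _ ≤ _ := Real.rpow_le_rpow (Real.rpow_nonneg infDist_nonneg _) (key s hs) (by positivity)
  calc _ ≤ (B ^ (1 / p)) ^ p := Real.rpow_le_rpow (arcHeight_nonneg _ _) hfin hp0.le
    _ = B := by rw [← Real.rpow_mul hB0, one_div_mul_cancel hp0.ne', Real.rpow_one]

end ArcHeight

theorem arcLen_diff_add_sum_le {X : Type*} [PseudoMetricSpace X] {γ : ℝ → X} {L : ℝ≥0}
    (hγ : LipschitzWith L γ) {D : Set ℝ} (N : Finset (ℝ × ℝ)) (hN : IsGapFamily N)
    (hD : ∀ n ∈ N, n.1 ∈ D ∧ n.2 ∈ D) :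
    arcLen γ (D \ ⋃ n ∈ N, Ioo n.1 n.2) 0 1 +
      ∑ n ∈ N, (arcLen γ D n.1 n.2 - dist (γ n.1) (γ n.2)) ≤ arcLen γ D 0 1 := by
  induction N using Finset.induction_on with
  | empty => simp
  | insert j S hj ih =>
    have hS : IsGapFamily S := by
      constructor
      · exact fun g hg => hN.nonneg g (Finset.mem_insert_of_mem hg)
      · exact fun g hg => hN.lt g (Finset.mem_insert_of_mem hg)
      · exact fun g hg => hN.le_one g (Finset.mem_insert_of_mem hg)
      · exact fun g hg h hh => hN.disj g (Finset.mem_insert_of_mem hg) h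
          (Finset.mem_insert_of_mem hh)
    have ih := ih hS fun n hn => hD n (Finset.mem_insert_of_mem hn)
    have hjm : j ∈ insert j S := Finset.mem_insert_self _ _
    obtain ⟨hj1, hj2⟩ := hD j hjm
    have h0 := hN.nonneg j hjm
    have h1 := hN.lt j hjm
    have h2 := hN.le_one j hjm
    have hne : ∀ g ∈ S, j ≠ g := fun g hg h => hj (h ▸ hg)
    have hdis : ∀ g ∈ S, Disjoint (Ioo j.1 j.2) (Ioo g.1 g.2) := fun g hg =>
      hN.disj j hjm g (Finset.mem_insert_of_mem hg) (hne g hg)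
    set D' := D \ ⋃ n ∈ S, Ioo n.1 n.2 with hD'
    set D'' := D \ ⋃ n ∈ insert j S, Ioo n.1 n.2 with hD''
    have hsub : D'' ⊆ D' := by
      refine sdiff_subset_sdiff_right ?_
      exact biUnion_subset_biUnion_left fun n hn => Finset.mem_insert_of_mem hn
    have hm : j.1 ∈ D'' ∧ j.2 ∈ D'' := by
      have key : ∀ g ∈ insert j S, j.1 ∉ Ioo g.1 g.2 ∧ j.2 ∉ Ioo g.1 g.2 := by
        intro g hg
        rcases Finset.mem_insert.1 hg with rfl | hg
        · simp
        · exact not_mem_Ioo_of_disjoint h1 (hdis g hg)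
      refine ⟨⟨hj1, ?_⟩, ⟨hj2, ?_⟩⟩ <;> simp only [mem_iUnion, not_exists]
      exacts [fun g hg => (key g hg).1, fun g hg => (key g hg).2]
    have hdD : Disjoint (Ioo j.1 j.2) D'' := by
      rw [disjoint_right]
      intro x hx hxj
      exact hx.2 (mem_biUnion (Finset.mem_coe.2 hjm) hxj)
    have hcongr : arcLen γ D' j.1 j.2 = arcLen γ D j.1 j.2 := by
      refine arcLen_congr ?_
      ext x
      refine ⟨fun hx => ⟨hx.1.1, hx.2⟩, fun hx => ⟨⟨hx.1, ?_⟩, hx.2⟩⟩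
      simp only [mem_iUnion, not_exists]
      intro g hg hxg
      rcases hx.2.1.eq_or_lt with h | h
      · exact (not_mem_Ioo_of_disjoint h1 (hdis g hg)).1 (h ▸ hxg)
      rcases hx.2.2.eq_or_lt with h' | h'
      · exact (not_mem_Ioo_of_disjoint h1 (hdis g hg)).2 (h' ▸ hxg)
      · exact disjoint_left.1 (hdis g hg) ⟨h, h'⟩ hxg
    have e1 := arcLen_add hγ h0 (h1.le.trans h2) hm.1
    have e2 := arcLen_add hγ h1.le h2 hm.2
    have e3 := arcLen_add hγ h0 (h1.le.trans h2) (hsub hm.1)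
    have e4 := arcLen_add hγ h1.le h2 (hsub hm.2)
    have e5 := arcLen_of_disjoint (γ := γ) h1.le hm.1 hm.2 hdD
    have e6 := arcLen_mono hγ (s := 0) (t := j.1) (inter_subset_inter_left _ hsub)
    have e7 := arcLen_mono hγ (s := j.2) (t := 1) (inter_subset_inter_left _ hsub)
    rw [Finset.sum_insert hj]
    linarith

/-- Add new gaps to a family, discarding the old gaps they cover. -/
def replaceGaps (G N : Finset (ℝ × ℝ)) : Finset (ℝ × ℝ) :=
  N ∪ G.filter fun g => ∀ n ∈ N, ¬ Ioo g.1 g.2 ⊆ Ioo n.1 n.2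

theorem gapCompl_replaceGaps (G N : Finset (ℝ × ℝ)) :
    gapCompl (replaceGaps G N) = gapCompl G \ ⋃ n ∈ N, Ioo n.1 n.2 := by
  ext s
  simp only [replaceGaps, mem_gapCompl, Finset.mem_union, Finset.mem_filter, mem_sdiff, mem_iUnion,
    not_exists]
  constructor
  · rintro ⟨h1, h2⟩
    refine ⟨⟨h1, fun g hg hs => ?_⟩, fun n hn => h2 n (Or.inl hn)⟩
    by_cases h : ∀ n ∈ N, ¬ Ioo g.1 g.2 ⊆ Ioo n.1 n.2
    · exact h2 g (Or.inr ⟨hg, h⟩) hs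
    · push Not at h
      obtain ⟨n, hn, hsub⟩ := h
      exact h2 n (Or.inl hn) (hsub hs)
  · rintro ⟨⟨h1, h2⟩, h3⟩
    refine ⟨h1, ?_⟩
    rintro g (hg | hg)
    exacts [h3 g hg, h2 g hg.1]

theorem IsGapFamily.replaceGaps {G N : Finset (ℝ × ℝ)} (hG : IsGapFamily G) (hN : IsGapFamily N)
    (hNG : ∀ n ∈ N, n.1 ∈ gapCompl G ∧ n.2 ∈ gapCompl G) : IsGapFamily (replaceGaps G N) := by
  have hcross : ∀ n ∈ N, ∀ g ∈ G, (∀ m ∈ N, ¬ Ioo g.1 g.2 ⊆ Ioo m.1 m.2) →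
      Disjoint (Ioo n.1 n.2) (Ioo g.1 g.2) := by
    intro n hn g hg h
    rw [disjoint_left]
    intro s hsn hsg
    obtain ⟨h1, h2⟩ := Ioo_subset_of_mem_gapCompl (hNG n hn).1 (hNG n hn).2 hg hsg
      ⟨hsn.1.le, hsn.2.le⟩
    exact h n hn (Ioo_subset_Ioo h1 h2)
  simp only [_root_.replaceGaps]
  constructor
  · intro g hg
    rcases Finset.mem_union.1 hg with h | h
    exacts [hN.nonneg g h, hG.nonneg g (Finset.mem_filter.1 h).1]
  · intro g hg
    rcases Finset.mem_union.1 hg with h | h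
    exacts [hN.lt g h, hG.lt g (Finset.mem_filter.1 h).1]
  · intro g hg
    rcases Finset.mem_union.1 hg with h | h
    exacts [hN.le_one g h, hG.le_one g (Finset.mem_filter.1 h).1]
  · intro g hg h hh hne
    rcases Finset.mem_union.1 hg with hg | hg <;> rcases Finset.mem_union.1 hh with hh | hh
    · exact hN.disj g hg h hh hne
    · exact hcross g hg h (Finset.mem_filter.1 hh).1 (Finset.mem_filter.1 hh).2
    · exact (hcross h hh g (Finset.mem_filter.1 hg).1 (Finset.mem_filter.1 hg).2).symm
    · exact hG.disj g (Finset.mem_filter.1 hg).1 h (Finset.mem_filter.1 hh).1 hne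

theorem HasMesh.replaceGaps {X : Type*} [PseudoMetricSpace X] {γ : ℝ → X} {G N : Finset (ℝ × ℝ)}
    {ε ε' : ℝ} (h : HasMesh γ (gapCompl G) ε) (hεε : ε ≤ ε') (hN : IsGapFamily N)
    (hNG : ∀ n ∈ N, n.1 ∈ gapCompl G ∧ n.2 ∈ gapCompl G)
    (hd : ∀ n ∈ N, ∀ u ∈ Icc n.1 n.2, ∀ v ∈ Icc n.1 n.2, dist (γ u) (γ v) ≤ ε') :
    HasMesh γ (gapCompl (replaceGaps G N)) ε' := by
  intro u v hu huv hv hdis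
  rw [gapCompl_replaceGaps] at hdis
  by_cases hD : Disjoint (Ioo u v) (gapCompl G)
  · exact (h u v hu huv hv hD).trans hεε
  rw [not_disjoint_iff] at hD
  obtain ⟨s, hs, hsD⟩ := hD
  have hs2 : s ∈ ⋃ n ∈ N, Ioo n.1 n.2 := by
    by_contra hcon
    exact disjoint_left.1 hdis hs ⟨hsD, hcon⟩
  simp only [mem_iUnion] at hs2
  obtain ⟨n, hn, hsn⟩ := hs2
  have key : n.1 ∉ Ioo u v ∧ n.2 ∉ Ioo u v := by
    have h1 := hN.mem_gapCompl hn
    have h2 := hNG n hn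
    constructor <;> intro hm <;> refine disjoint_left.1 hdis hm ⟨by tauto, ?_⟩ <;>
      simp only [mem_iUnion, not_exists]
    · exact (mem_gapCompl.1 h1.1).2
    · exact (mem_gapCompl.1 h1.2).2
  have h1 : n.1 ≤ u := by
    by_contra! hcon
    exact key.1 ⟨hcon, hsn.1.trans hs.2⟩
  have h2 : v ≤ n.2 := by
    by_contra! hcon
    exact key.2 ⟨hs.1.trans hsn.2, hcon⟩
  exact hd n hn u ⟨h1, huv.trans h2⟩ v ⟨h1.trans huv, h2⟩

/-- The `p`-energy of the heights of the gaps. -/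
def gapEnergy {X : Type*} [NormedAddCommGroup X] [NormedSpace ℝ X] (γ : ℝ → X) (p : ℝ)
    (G : Finset (ℝ × ℝ)) : ℝ := ∑ g ∈ G, arcHeight γ g.1 g.2 ^ p

theorem gapEnergy_nonneg {X : Type*} [NormedAddCommGroup X] [NormedSpace ℝ X] (γ : ℝ → X) (p : ℝ)
    (G : Finset (ℝ × ℝ)) : 0 ≤ gapEnergy γ p G :=
  Finset.sum_nonneg fun _ _ => Real.rpow_nonneg (arcHeight_nonneg _ _) _

theorem gapEnergy_replaceGaps_le {X : Type*} [NormedAddCommGroup X] [NormedSpace ℝ X] {γ : ℝ → X}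
    {L : ℝ≥0} {p c : ℝ} (hp : 2 ≤ p) (hc : 0 < c) (hX : HasExcessBound X p c)
    (hγ : LipschitzWith L γ) {G N : Finset (ℝ × ℝ)} (hG : IsGapFamily G) (hN : IsGapFamily N)
    (hNG : ∀ n ∈ N, n.1 ∈ gapCompl G ∧ n.2 ∈ gapCompl G) {R : ℝ}
    (hR : ∀ n ∈ N, ∀ t ∈ Icc n.1 n.2, dist (γ n.1) (γ t) ≤ R) :
    gapEnergy γ p (replaceGaps G N) ≤ 2 ^ (p - 1) * (gapEnergy γ p G + R ^ (p - 1) / c *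
      ∑ n ∈ N, (arcLen γ (gapCompl G) n.1 n.2 - dist (γ n.1) (γ n.2))) := by
  have hpos : ∀ g : ℝ × ℝ, 0 ≤ arcHeight γ g.1 g.2 ^ p := fun g =>
    Real.rpow_nonneg (arcHeight_nonneg _ _) _
  set f : ℝ × ℝ → ℝ := fun g => arcHeight γ g.1 g.2 ^ p with hf
  set F : ℝ × ℝ → Finset (ℝ × ℝ) := fun n => G.filter fun g => Ioo g.1 g.2 ⊆ Ioo n.1 n.2 with hF
  set Kp := G.filter fun g => ∀ n ∈ N, ¬ Ioo g.1 g.2 ⊆ Ioo n.1 n.2 with hKp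
  have hone : (1 : ℝ) ≤ 2 ^ (p - 1) := Real.one_le_rpow (by norm_num) (by linarith)
  have h1 : gapEnergy γ p (replaceGaps G N) ≤ ∑ n ∈ N, f n + ∑ g ∈ Kp, f g := by
    rw [gapEnergy, replaceGaps, ← Finset.sum_union_inter]
    exact le_add_of_nonneg_right (Finset.sum_nonneg fun g _ => hpos g)
  have h2 : ∑ n ∈ N, f n ≤ ∑ n ∈ N, 2 ^ (p - 1) * (∑ g ∈ F n, f g +
      R ^ (p - 1) / c * (arcLen γ (gapCompl G) n.1 n.2 - dist (γ n.1) (γ n.2))) :=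
    Finset.sum_le_sum fun n hn => arcHeight_rpow_le hp hc hX hγ hG (hN.lt n hn).le
      (hNG n hn).1 (hNG n hn).2 (hR n hn)
  have hdisj : (N : Set (ℝ × ℝ)).PairwiseDisjoint F := by
    intro n hn m hm hne
    rw [Function.onFun, Finset.disjoint_left]
    intro g hg1 hg2
    have hgG := (Finset.mem_filter.1 hg1).1
    obtain ⟨s, hs⟩ := nonempty_Ioo.2 (hG.lt g hgG)
    exact disjoint_left.1 (hN.disj n hn m hm hne) ((Finset.mem_filter.1 hg1).2 hs)
      ((Finset.mem_filter.1 hg2).2 hs)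
  have hdisj2 : Disjoint (N.biUnion F) Kp := by
    rw [Finset.disjoint_left]
    intro g hg1 hg2
    obtain ⟨n, hn, hgn⟩ := Finset.mem_biUnion.1 hg1
    exact (Finset.mem_filter.1 hg2).2 n hn (Finset.mem_filter.1 hgn).2
  have h3 : ∑ n ∈ N, ∑ g ∈ F n, f g + ∑ g ∈ Kp, f g ≤ gapEnergy γ p G := by
    rw [← Finset.sum_biUnion hdisj, ← Finset.sum_union hdisj2]
    refine Finset.sum_le_sum_of_subset_of_nonneg ?_ fun g _ _ => hpos g
    refine Finset.union_subset (Finset.biUnion_subset.2 fun n _ => Finset.filter_subset _ _)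
      (Finset.filter_subset _ _)
  rw [← Finset.mul_sum, Finset.sum_add_distrib, ← Finset.mul_sum] at h2
  have h4 : ∑ g ∈ Kp, f g ≤ 2 ^ (p - 1) * ∑ g ∈ Kp, f g :=
    le_mul_of_one_le_left (Finset.sum_nonneg fun g _ => hpos g) hone
  calc _ ≤ _ := h1
    _ ≤ 2 ^ (p - 1) * ((∑ n ∈ N, ∑ g ∈ F n, f g + ∑ g ∈ Kp, f g) + R ^ (p - 1) / c *
      ∑ n ∈ N, (arcLen γ (gapCompl G) n.1 n.2 - dist (γ n.1) (γ n.2))) := by linarith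
    _ ≤ _ := by gcongr

/-- Some long arc of `γ` through `x` stays close to its chord at scale `r`. -/
def IsFlatAt {X : Type*} [NormedAddCommGroup X] [NormedSpace ℝ X] (γ : ℝ → X) (K η r : ℝ)
    (x : X) : Prop :=
  ∃ a b t, 0 ≤ a ∧ b ≤ 1 ∧ t ∈ Icc a b ∧ γ t = x ∧ K * r ≤ dist x (γ a) ∧ K * r ≤ dist x (γ b) ∧
    ∀ s ∈ Icc a b, infDist (γ s) (segment ℝ (γ a) (γ b)) ≤ η * r

theorem IsStepChain.isFlatAt {X : Type*} [NormedAddCommGroup X] [NormedSpace ℝ X] {γ : ℝ → X}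
    {L : ℝ≥0} (hγ : LipschitzWith L γ) {D : Set ℝ} (hD : D ⊆ Icc 0 1) {r R K η : ℝ}
    {σ : ℕ → ℝ} {n : ℕ} (h : IsStepChain γ D (r / 3) R σ n) (hr : 0 < r) (hR : 2 * R ≤ r)
    {N i : ℕ} (hN : 3 * (K + 2) ≤ N) (hNi : N ≤ i) (hin : i + N + 1 < n)
    {t : ℝ} (ht : t ∈ Icc (σ i) (σ (i + 1)))
    (hE : arcLen γ D (σ (i - N)) (σ (i + N + 1)) - dist (γ (σ (i - N))) (γ (σ (i + N + 1))) ≤ r)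
    (hΩ : arcHeight γ (σ (i - N)) (σ (i + N + 1)) ≤ η * r) : IsFlatAt γ K η r (γ t) := by
  have m1 : σ (i - N) ≤ σ i := h.mono (by omega)
  have m2 : σ (i + 1) ≤ σ (i + N + 1) := h.mono (by omega)
  have m3 : σ i ≤ σ (i + 1) := h.mono (by omega)
  have hKN : (K + 2) * r ≤ N * (r / 3) := by nlinarith
  have hx1 : dist (γ (σ i)) (γ t) ≤ R := h.dist_le i t ht
  have hx2 : dist (γ (σ i)) (γ (σ (i + 1))) ≤ R := h.dist_le i _ ⟨m3, le_rfl⟩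
  have hR0 : 0 ≤ R := dist_nonneg.trans hx1
  refine ⟨σ (i - N), σ (i + N + 1), t, (hD (h.mem _)).1, (hD (h.mem _)).2,
    ⟨m1.trans ht.1, ht.2.trans m2⟩, rfl, ?_, ?_, fun s hs => (infDist_le_arcHeight hγ hs).trans hΩ⟩
  · have h1 := h.mul_le_arcLen hγ (i - N) N (by omega)
    rw [Nat.sub_add_cancel hNi] at h1
    have h2 := arcLen_add hγ m1 (m3.trans m2) (h.mem i)
    have h3 := dist_le_arcLen hγ (m3.trans m2) (h.mem i) (h.mem (i + N + 1))
    have h4 := dist_triangle (γ (σ (i - N))) (γ (σ i)) (γ (σ (i + N + 1)))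
    have h5 := dist_triangle_right (γ (σ (i - N))) (γ (σ i)) (γ t)
    rw [dist_comm (γ t)]
    linarith
  · have h1 := h.mul_le_arcLen hγ (i + 1) N (by omega)
    rw [show i + 1 + N = i + N + 1 by omega] at h1
    have h2 := arcLen_add hγ (m1.trans m3) m2 (h.mem (i + 1))
    have h3 := dist_le_arcLen hγ (m1.trans m3) (h.mem (i - N)) (h.mem (i + 1))
    have h4 := dist_triangle (γ (σ (i - N))) (γ (σ (i + 1))) (γ (σ (i + N + 1)))
    have h5 := dist_triangle (γ (σ (i + 1))) (γ t) (γ (σ (i + N + 1)))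
    have h6 := dist_triangle_left (γ (σ (i + 1))) (γ t) (γ (σ i))
    linarith

theorem exists_finset_mul_sum_ge {ι : Type*} (I : Finset ι) (col : ι → ℕ) {m : ℕ} (hm : 0 < m)
    (w : ι → ℝ) :
    ∃ q < m, ∑ x ∈ I, w x ≤ m * ∑ x ∈ I with col x % m = q, w x := by
  have h1 : ∑ q ∈ Finset.range m, ∑ x ∈ I with col x % m = q, w x = ∑ x ∈ I, w x :=
    Finset.sum_fiberwise_of_maps_to (fun x _ => Finset.mem_range.2 (Nat.mod_lt _ hm)) _
  have hm' : (m : ℝ) ≠ 0 := by positivity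
  obtain ⟨q, hq, hle⟩ := Finset.exists_le_of_sum_le (s := Finset.range m)
    (f := fun _ => (∑ x ∈ I, w x) / m) (g := fun q => ∑ x ∈ I with col x % m = q, w x)
    ⟨0, Finset.mem_range.2 hm⟩ (by
      rw [h1, Finset.sum_const, Finset.card_range, nsmul_eq_mul, mul_div_cancel₀ _ hm'])
  refine ⟨q, Finset.mem_range.1 hq, ?_⟩
  rwa [div_le_iff₀' (by positivity)] at hle

theorem rpow_mul_le_of_not_isFlatAt {p ε₁ b r E Ω : ℝ} (hp : 2 ≤ p) (hε₁ : 0 < ε₁) (hb : 0 ≤ b)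
    (hb1 : b ≤ 1) (hr : 0 < r) (hE : 0 ≤ E) (hΩ : 0 ≤ Ω) (h : ε₁ * b * r < E ∨ ε₁ * b * r < Ω) :
    b ^ p * r ≤ ε₁ ^ (-p) * (r ^ (1 - p) * Ω ^ p) + ε₁⁻¹ * E := by
  have hb2 : b ^ p ≤ b := by
    calc b ^ p ≤ b ^ (1 : ℝ) := Real.rpow_le_rpow_of_exponent_ge' hb hb1 zero_le_one (by linarith)
      _ = b := Real.rpow_one b
  rcases h with h | h
  · have h1 : b * r ≤ ε₁⁻¹ * E := by
      rw [le_inv_mul_iff₀ hε₁]; linarith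
    have h2 : b ^ p * r ≤ b * r := by gcongr
    have : 0 ≤ ε₁ ^ (-p) * (r ^ (1 - p) * Ω ^ p) := by positivity
    linarith
  · have h1 : (ε₁ * b * r) ^ p ≤ Ω ^ p := Real.rpow_le_rpow (by positivity) h.le (by linarith)
    have h2 : b ^ p * r = ε₁ ^ (-p) * (r ^ (1 - p) * (ε₁ * b * r) ^ p) := by
      rw [Real.mul_rpow (by positivity) hr.le, Real.mul_rpow hε₁.le hb]
      have e1 : ε₁ ^ (-p) * ε₁ ^ p = 1 := by rw [← Real.rpow_add hε₁]; simp
      have e2 : r ^ (1 - p) * r ^ p = r := by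
        rw [← Real.rpow_add hr, sub_add_cancel, Real.rpow_one]
      calc b ^ p * r = (ε₁ ^ (-p) * ε₁ ^ p) * b ^ p * (r ^ (1 - p) * r ^ p) := by rw [e1, e2]; ring
        _ = _ := by ring
    have h3 : 0 ≤ ε₁⁻¹ * E := by positivity
    have h4 : ε₁ ^ (-p) * (r ^ (1 - p) * (ε₁ * b * r) ^ p) ≤
        ε₁ ^ (-p) * (r ^ (1 - p) * Ω ^ p) := by gcongr
    linarith

theorem exists_replaceGaps_of_color {X : Type*} [NormedAddCommGroup X] [NormedSpace ℝ X]
    {γ : ℝ → X} {L : ℝ≥0} {p c : ℝ} (hp : 2 ≤ p) (hc : 0 < c) (hX : HasExcessBound X p c)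
    (hγ : LipschitzWith L γ) {G : Finset (ℝ × ℝ)} (hG : IsGapFamily G) {ε r K ε₁ : ℝ}
    (hr : 0 < r) (hε₁ : 0 < ε₁) (hε₁1 : ε₁ ≤ 1)
    (hεr : ε ≤ r / 60) (hmesh : HasMesh γ (gapCompl G) ε)
    {σ : ℕ → ℝ} {n : ℕ} (hσ : IsStepChain γ (gapCompl G) (r / 3) (r / 3 + ε) σ n)
    {N : ℕ} (hN : 3 * (K + 2) ≤ N) {b : X → ℝ} (hb : ∀ x, 0 ≤ b x) (hb1 : ∀ x, b x ≤ 1)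
    (I : Finset X) (ι : X → ℕ) {q : ℕ} (hι : InjOn ι I) (hq : ∀ x ∈ I, ι x % (2 * N + 1) = q)
    (hιN : ∀ x ∈ I, N ≤ ι x) (hιn : ∀ x ∈ I, ι x + N + 1 < n)
    (hιt : ∀ x ∈ I, ∃ t ∈ Icc (σ (ι x)) (σ (ι x + 1)), γ t = x)
    (hnf : ∀ x ∈ I, ¬ IsFlatAt γ K (ε₁ * b x) r x) :
    ∃ G', IsGapFamily G' ∧ HasMesh γ (gapCompl G') ((2 * N + 2) * r) ∧ ∃ Δ, 0 ≤ Δ ∧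
      arcLen γ (gapCompl G') 0 1 + Δ ≤ arcLen γ (gapCompl G) 0 1 ∧
      gapEnergy γ p G' ≤ 2 ^ (p - 1) * (gapEnergy γ p G + ((2 * N + 2) * r) ^ (p - 1) / c * Δ) ∧
      ∑ x ∈ I, b x ^ p * r ≤ ε₁ ^ (-p) * (r ^ (1 - p) * gapEnergy γ p G') + ε₁⁻¹ * Δ := by
  set D := gapCompl G with hD
  have hr3 : 0 < r / 3 := by positivity
  have hstrict : ∀ {i j}, i < j → j < n → σ i < σ j := fun hij hj => hσ.lt_of_lt hr3 hij hj
  set P : X → ℝ × ℝ := fun x => (σ (ι x - N), σ (ι x + N + 1)) with hP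
  have hPinj : InjOn P I := by
    intro x hx y hy hxy
    refine hι hx hy ?_
    have h1 : σ (ι x + N + 1) = σ (ι y + N + 1) := congrArg Prod.snd hxy
    rcases lt_trichotomy (ι x) (ι y) with h | h | h
    · exact absurd h1 (hstrict (by omega) (hιn y hy)).ne
    · exact h
    · exact absurd h1 (hstrict (by omega) (hιn x hx)).ne'
  set New := I.image P with hNew
  have hNewF : IsGapFamily New := by
    constructor
    · simp only [hNew, Finset.forall_mem_image]
      exact fun x _ => (gapCompl_subset G (hσ.mem _)).1
    · simp only [hNew, Finset.forall_mem_image]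
      intro x hx
      exact hstrict (by omega) (hιn x hx)
    · simp only [hNew, Finset.forall_mem_image]
      exact fun x _ => (gapCompl_subset G (hσ.mem _)).2
    · simp only [hNew, Finset.forall_mem_image]
      have key : ∀ x ∈ I, ∀ y ∈ I, ι x < ι y →
          Disjoint (Ioo (P x).1 (P x).2) (Ioo (P y).1 (P y).2) := by
        intro x hx y hy hlt
        have hgap : ι x + (2 * N + 1) ≤ ι y := by
          have h1 := hq x hx
          have h2 := hq y hy
          have h3 : (ι y - ι x) % (2 * N + 1) = 0 := Nat.sub_mod_eq_zero_of_mod_eq (h2.trans h1.symm)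
          have h4 := Nat.le_of_dvd (by omega) (Nat.dvd_of_mod_eq_zero h3)
          omega
        have h5 : (P x).2 ≤ (P y).1 := hσ.mono (by have := hιN y hy; omega)
        rw [disjoint_left]
        intro s hs hs'
        exact absurd (hs.2.trans_le h5) (not_lt.2 hs'.1.le)
      intro x hx y hy hne
      rcases lt_trichotomy (ι x) (ι y) with h | h | h
      · exact key x hx y hy h
      · exact absurd (by rw [hι hx hy h]) hne
      · exact (key y hy x hx h).symm
  have hNewG : ∀ m ∈ New, m.1 ∈ gapCompl G ∧ m.2 ∈ gapCompl G := by
    simp only [hNew, Finset.forall_mem_image]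
    exact fun x _ => ⟨hσ.mem _, hσ.mem _⟩
  have hdist : ∀ m ∈ New, ∀ t ∈ Icc m.1 m.2, dist (γ m.1) (γ t) ≤ (2 * N + 1) * (r / 3 + ε) := by
    simp only [hNew, Finset.forall_mem_image]
    intro x hx t ht
    have h1 := hσ.dist_le_mul (ι x - N) (2 * N + 1) (t := t) (by
      have := hιN x hx
      rwa [show ι x - N + (2 * N + 1) = ι x + N + 1 by omega])
    push_cast at h1
    exact h1
  have hNn : (0 : ℝ) ≤ N := by positivity
  set R := (2 * N + 2) * r with hR
  have hR1 : 2 * ((2 * N + 1) * (r / 3 + ε)) ≤ R := by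
    have : 2 * (r / 3 + ε) ≤ r := by linarith
    rw [hR]; nlinarith
  have hdist2 : ∀ m ∈ New, ∀ t ∈ Icc m.1 m.2, dist (γ m.1) (γ t) ≤ R := by
    intro m hm t ht
    have h1 := hdist m hm t ht
    have h0 : 0 ≤ dist (γ m.1) (γ t) := dist_nonneg
    linarith
  set E : ℝ × ℝ → ℝ := fun m => arcLen γ D m.1 m.2 - dist (γ m.1) (γ m.2) with hE
  have hE0 : ∀ m ∈ New, 0 ≤ E m := fun m hm => sub_nonneg.2
    (dist_le_arcLen hγ (hNewF.lt m hm).le (hNewG m hm).1 (hNewG m hm).2)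
  have hfam := hG.replaceGaps hNewF hNewG
  refine ⟨replaceGaps G New, hfam, ?_, ∑ m ∈ New, E m, Finset.sum_nonneg hE0, ?_, ?_, ?_⟩
  · refine hmesh.replaceGaps ?_ hNewF hNewG ?_
    · rw [hR]; nlinarith
    · intro m hm u hu v hv
      have h1 := hdist m hm u hu
      have h2 := hdist m hm v hv
      have h3 := dist_triangle_left (γ u) (γ v) (γ m.1)
      linarith
  · rw [gapCompl_replaceGaps]
    exact arcLen_diff_add_sum_le hγ New hNewF hNewG
  · exact gapEnergy_replaceGaps_le hp hc hX hγ hG hNewF hNewG hdist2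
  · have hle : ∑ m ∈ New, arcHeight γ m.1 m.2 ^ p ≤ gapEnergy γ p (replaceGaps G New) :=
      Finset.sum_le_sum_of_subset_of_nonneg Finset.subset_union_left
        fun g _ _ => Real.rpow_nonneg (arcHeight_nonneg _ _) _
    have hterm : ∀ x ∈ I, b x ^ p * r ≤
        ε₁ ^ (-p) * (r ^ (1 - p) * arcHeight γ (P x).1 (P x).2 ^ p) + ε₁⁻¹ * E (P x) := by
      intro x hx
      refine rpow_mul_le_of_not_isFlatAt hp hε₁ (hb x) (hb1 x) hr
        (hE0 _ (Finset.mem_image_of_mem P hx)) (arcHeight_nonneg _ _) ?_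
      by_contra! hcon
      obtain ⟨t, ht, rfl⟩ := hιt x hx
      refine hnf _ hx ?_
      refine hσ.isFlatAt hγ (gapCompl_subset G) hr (by linarith) hN (hιN _ hx) (hιn _ hx) ht ?_
        hcon.2
      refine hcon.1.trans ?_
      have : ε₁ * b (γ t) ≤ 1 := mul_le_one₀ hε₁1 (hb _) (hb1 _)
      nlinarith
    calc _ ≤ ∑ x ∈ I, (ε₁ ^ (-p) * (r ^ (1 - p) * arcHeight γ (P x).1 (P x).2 ^ p) +
          ε₁⁻¹ * E (P x)) := Finset.sum_le_sum hterm
      _ = ε₁ ^ (-p) * (r ^ (1 - p) * ∑ m ∈ New, arcHeight γ m.1 m.2 ^ p) +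
          ε₁⁻¹ * ∑ m ∈ New, E m := by
        rw [hNew, Finset.sum_image hPinj, Finset.sum_image hPinj, Finset.sum_add_distrib,
          Finset.mul_sum, Finset.mul_sum, Finset.mul_sum]
      _ ≤ _ := by gcongr

/-- One level of the non-flat estimate. -/
theorem exists_replaceGaps_level {X : Type*} [NormedAddCommGroup X] [NormedSpace ℝ X]
    {γ : ℝ → X} {L : ℝ≥0} {p c : ℝ} (hp : 2 ≤ p) (hc : 0 < c) (hX : HasExcessBound X p c)
    (hγ : LipschitzWith L γ) {G : Finset (ℝ × ℝ)} (hG : IsGapFamily G) {ε r K ε₁ : ℝ}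
    (hr : 0 < r) (hε₁ : 0 < ε₁) (hε₁1 : ε₁ ≤ 1) (hε0 : 0 ≤ ε)
    (hεr : ε ≤ r / 60) (hmesh : HasMesh γ (gapCompl G) ε)
    {N : ℕ} (hN : 3 * (K + 2) ≤ N) {b : X → ℝ} (hb : ∀ x, 0 ≤ b x) (hb1 : ∀ x, b x ≤ 1)
    (T : Finset X) (hT : ∀ x ∈ T, x ∈ γ '' Icc 0 1)
    (hsep : ∀ x ∈ T, ∀ y ∈ T, x ≠ y → r ≤ dist x y) :
    ∃ G', IsGapFamily G' ∧ HasMesh γ (gapCompl G') ((2 * N + 2) * r) ∧ ∃ Δ, 0 ≤ Δ ∧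
      arcLen γ (gapCompl G') 0 1 + Δ ≤ arcLen γ (gapCompl G) 0 1 ∧
      gapEnergy γ p G' ≤ 2 ^ (p - 1) * (gapEnergy γ p G + ((2 * N + 2) * r) ^ (p - 1) / c * Δ) ∧
      ∑ x ∈ T with ¬ IsFlatAt γ K (ε₁ * b x) r x, b x ^ p * r ≤
        (2 * N + 1) * (ε₁ ^ (-p) * (r ^ (1 - p) * gapEnergy γ p G') + ε₁⁻¹ * Δ) +
          (2 * N + 2) * r := by
  obtain ⟨σ, n, hσ⟩ := exists_isStepChain hγ (isClosed_gapCompl G) (gapCompl_subset G)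
    hG.zero_mem hG.one_mem hε0 (show 0 < r / 3 by positivity) hmesh
  have hex : ∀ x : X, ∃ i, x ∈ T → i < n ∧ ∃ t ∈ Icc (σ i) (σ (i + 1)), γ t = x := by
    intro x
    by_cases hx : x ∈ T
    · obtain ⟨t, ht, rfl⟩ := hT x hx
      obtain ⟨i, hi, hti⟩ := hσ.exists_mem_Icc ht
      exact ⟨i, fun _ => ⟨hi, t, hti, rfl⟩⟩
    · exact ⟨0, fun h => absurd h hx⟩
  choose ι hι using hex
  have hinj : InjOn ι T := by
    intro x hx y hy hxy
    by_contra hne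
    obtain ⟨-, s, hs, hsx⟩ := hι x hx
    obtain ⟨-, t, ht, hty⟩ := hι y hy
    rw [← hxy] at ht
    have h1 := hσ.dist_le _ s hs
    have h2 := hσ.dist_le _ t ht
    have h3 := dist_triangle_left (γ s) (γ t) (γ (σ (ι x)))
    rw [hsx, hty] at h3
    have h4 := hsep x hx y hy hne
    rw [hsx] at h1
    rw [hty] at h2
    linarith
  set T' := T.filter fun x => ¬ IsFlatAt γ K (ε₁ * b x) r x with hT'
  set I := T'.filter fun x => N ≤ ι x ∧ ι x + N + 1 < n with hI
  obtain ⟨q, -, hcol⟩ := exists_finset_mul_sum_ge I ι (show 0 < 2 * N + 1 by omega)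
    fun x => b x ^ p * r
  have hsubT : ∀ x ∈ I.filter (fun x => ι x % (2 * N + 1) = q), x ∈ T := fun x hx =>
    (Finset.mem_filter.1 (Finset.mem_filter.1 (Finset.mem_filter.1 hx).1).1).1
  obtain ⟨G', hG', hmesh', Δ, hΔ, hlen, hen, hsum⟩ :=
    exists_replaceGaps_of_color hp hc hX hγ hG hr hε₁ hε₁1 hεr hmesh hσ hN hb hb1
      (I.filter fun x => ι x % (2 * N + 1) = q) ι (hinj.mono hsubT)
      (fun x hx => (Finset.mem_filter.1 hx).2)
      (fun x hx => (Finset.mem_filter.1 (Finset.mem_filter.1 hx).1).2.1)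
      (fun x hx => (Finset.mem_filter.1 (Finset.mem_filter.1 hx).1).2.2)
      (fun x hx => (hι x (hsubT x hx)).2)
      (fun x hx => (Finset.mem_filter.1 (Finset.mem_filter.1 (Finset.mem_filter.1 hx).1).1).2)
  refine ⟨G', hG', hmesh', Δ, hΔ, hlen, hen, ?_⟩
  rw [← Finset.sum_filter_add_sum_filter_not T' (fun x => N ≤ ι x ∧ ι x + N + 1 < n)]
  refine add_le_add ?_ ?_
  · refine hcol.trans ?_
    push_cast
    gcongr
  · set B := T'.filter fun x => ¬ (N ≤ ι x ∧ ι x + N + 1 < n) with hB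
    have hBT : ∀ x ∈ B, x ∈ T := fun x hx => (Finset.mem_filter.1 (Finset.mem_filter.1 hx).1).1
    have hcard : B.card ≤ 2 * N + 2 := by
      have h1 : B.card ≤ (Finset.range N ∪ Finset.Ico (n - (N + 1)) n).card := by
        refine Finset.card_le_card_of_injOn ι ?_ (hinj.mono hBT)
        intro x hx
        have h2 := (hι x (hBT x hx)).1
        have h3 := (Finset.mem_filter.1 hx).2
        simp only [Finset.coe_union, Finset.coe_range, Finset.coe_Ico, mem_union, mem_Iio, mem_Ico]
        omega
      have h2 := Finset.card_union_le (Finset.range N) (Finset.Ico (n - (N + 1)) n)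
      simp only [Finset.card_range, Nat.card_Ico] at h2
      omega
    calc ∑ x ∈ B, b x ^ p * r ≤ ∑ x ∈ B, 1 * r := by
          refine Finset.sum_le_sum fun x _ => ?_
          gcongr
          exact Real.rpow_le_one (hb x) (hb1 x) (by linarith)
      _ = B.card * r := by simp
      _ ≤ (2 * N + 2) * r := by
        gcongr
        exact_mod_cast hcard

theorem hasMesh_gapCompl_empty {X : Type*} [PseudoMetricSpace X] (γ : ℝ → X) {ε : ℝ}
    (hε : 0 ≤ ε) : HasMesh γ (gapCompl ∅) ε := by
  intro u v hu huv hv hd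
  rcases huv.eq_or_lt with rfl | h
  · simpa using hε
  · exact absurd hd (not_disjoint_iff.2 ⟨(u + v) / 2, ⟨by linarith, by linarith⟩,
      by simp only [gapCompl, Finset.notMem_empty, iUnion_of_empty, iUnion_empty, sdiff_empty]
         exact ⟨by linarith, by linarith⟩⟩)

theorem isGapFamily_empty : IsGapFamily ∅ := by
  constructor <;> simp

theorem exists_replaceGaps_of_levels {X : Type*} [NormedAddCommGroup X] [NormedSpace ℝ X]
    {γ : ℝ → X} {L : ℝ≥0} {p c : ℝ} (hp : 2 ≤ p) (hc : 0 < c) (hX : HasExcessBound X p c)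
    (hγ : LipschitzWith L γ) {K ε₁ ρ Λ : ℝ} (hρ : 0 < ρ) (hε₁ : 0 < ε₁) (hε₁1 : ε₁ ≤ 1)
    {N : ℕ} (hN : 3 * (K + 2) ≤ N) (hΛ : 60 * (2 * N + 2) ≤ Λ) {b : ℕ → X → ℝ}
    (hb : ∀ j x, 0 ≤ b j x) (hb1 : ∀ j x, b j x ≤ 1)
    (T : ℕ → Finset X) (hT : ∀ j, ∀ x ∈ T j, x ∈ γ '' Icc 0 1)
    (hsep : ∀ j, ∀ x ∈ T j, ∀ y ∈ T j, x ≠ y → ρ * Λ ^ j ≤ dist x y)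
    {c₂ a : ℝ} (hc₂ : c₂ = (2 * N + 1) * ε₁ ^ (-p)) (ha : a = 2 * c₂ * 2 ^ (p - 1)) (m : ℕ) :
    ∃ G, IsGapFamily G ∧ HasMesh γ (gapCompl G) (ρ * Λ ^ m / 60) ∧
      (∑ j ∈ Finset.range m,
        ∑ x ∈ T j with ¬ IsFlatAt γ K (ε₁ * b j x) (ρ * Λ ^ j) x, b j x ^ p * (ρ * Λ ^ j)) +
          a * ((ρ * Λ ^ m) ^ (1 - p) * gapEnergy γ p G) +
          (a * ((2 * N + 2) ^ (p - 1) / c) + c₂) * arcLen γ (gapCompl G) 0 1 ≤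
        (a * ((2 * N + 2) ^ (p - 1) / c) + c₂) * arcLen γ (Icc 0 1) 0 1 +
          (2 * N + 2) * ∑ j ∈ Finset.range m, ρ * Λ ^ j := by
  have hN0 : (0 : ℝ) ≤ N := N.cast_nonneg
  have hΛ0 : 0 < Λ := by linarith
  induction m with
  | zero =>
    refine ⟨∅, isGapFamily_empty, hasMesh_gapCompl_empty γ (by positivity), ?_⟩
    simp [gapEnergy, gapCompl]
  | succ m ih =>
    obtain ⟨G, hG, hmesh, hle⟩ := ih
    have hr : 0 < ρ * Λ ^ m := by positivity
    obtain ⟨G', hG', hmesh', Δ, hΔ, hlen, hen, hsum⟩ := exists_replaceGaps_level hp hc hX hγ hG hr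
      hε₁ hε₁1 (by positivity) le_rfl hmesh hN (hb m) (hb1 m) (T m) (hT m) (hsep m)
    refine ⟨G', hG', ?_, ?_⟩
    · intro u v hu huv hv hd
      refine (hmesh' u v hu huv hv hd).trans ?_
      rw [pow_succ]
      nlinarith
    have hc₂0 : 0 < c₂ := by rw [hc₂]; positivity
    have ha0 : 0 < a := by rw [ha]; positivity
    have h1 : (ρ * Λ ^ (m + 1)) ^ (1 - p) = (ρ * Λ ^ m) ^ (1 - p) * Λ ^ (1 - p) := by
      rw [pow_succ, ← mul_assoc, Real.mul_rpow hr.le hΛ0.le]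
    have h2 : a * Λ ^ (1 - p) ≤ c₂ := by
      have e1 : (4 : ℝ) ^ (p - 1) ≤ Λ ^ (p - 1) :=
        Real.rpow_le_rpow (by norm_num) (by linarith) (by linarith)
      have e2 : (4 : ℝ) ^ (p - 1) = 2 ^ (p - 1) * 2 ^ (p - 1) := by
        rw [← Real.mul_rpow (by norm_num) (by norm_num)]; norm_num
      have e3 : (2 : ℝ) ≤ 2 ^ (p - 1) := by
        calc (2 : ℝ) = 2 ^ (1 : ℝ) := (Real.rpow_one 2).symm
          _ ≤ _ := Real.rpow_le_rpow_of_exponent_le (by norm_num) (by linarith)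
      have e4 : Λ ^ (1 - p) = (Λ ^ (p - 1))⁻¹ := by
        rw [← Real.rpow_neg hΛ0.le]; ring_nf
      rw [e4, mul_inv_le_iff₀ (by positivity), ha]
      have : 2 * 2 ^ (p - 1) ≤ Λ ^ (p - 1) := by nlinarith
      nlinarith
    have h3 : (2 * N + 1) * ε₁⁻¹ ≤ c₂ := by
      rw [hc₂]
      gcongr
      rw [← Real.rpow_neg_one]
      exact Real.rpow_le_rpow_of_exponent_ge hε₁ hε₁1 (by linarith)
    have h4 : (ρ * Λ ^ m) ^ (1 - p) * (ρ * Λ ^ m) ^ (p - 1) = 1 := by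
      rw [← Real.rpow_add hr]; simp
    have h5 : ((2 * N + 2 : ℝ) * (ρ * Λ ^ m)) ^ (p - 1) =
        (2 * N + 2 : ℝ) ^ (p - 1) * (ρ * Λ ^ m) ^ (p - 1) :=
      Real.mul_rpow (by positivity) hr.le
    rw [h5] at hen
    rw [Finset.sum_range_succ, Finset.sum_range_succ, h1]
    have hZ := gapEnergy_nonneg γ p G'
    generalize gapEnergy γ p G' = Z' at *
    generalize gapEnergy γ p G = Z at *
    have hx : 0 < (ρ * Λ ^ m) ^ (1 - p) := by positivity
    set x := (ρ * Λ ^ m) ^ (1 - p)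
    set y := (ρ * Λ ^ m) ^ (p - 1)
    set k := (2 * N + 2 : ℝ) ^ (p - 1)
    have h6 : a * (x * Λ ^ (1 - p) * Z') ≤ c₂ * (x * Z') := by
      calc a * (x * Λ ^ (1 - p) * Z') = a * Λ ^ (1 - p) * (x * Z') := by ring
        _ ≤ _ := by gcongr
    have h7 : 2 * c₂ * (x * Z') ≤ a * (x * Z) + a * (k / c) * Δ := by
      calc 2 * c₂ * (x * Z') ≤ 2 * c₂ * (x * (2 ^ (p - 1) * (Z + k * y / c * Δ))) := by gcongr
        _ = a * (x * Z) + a * (k / c) * Δ * (x * y) := by rw [ha]; ring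
        _ = _ := by rw [h4, mul_one]
    have h8 : (2 * N + 1) * (ε₁ ^ (-p) * (x * Z') + ε₁⁻¹ * Δ) ≤ c₂ * (x * Z') + c₂ * Δ := by
      have : (2 * N + 1) * ε₁⁻¹ * Δ ≤ c₂ * Δ := by gcongr
      calc _ = (2 * N + 1) * ε₁ ^ (-p) * (x * Z') + (2 * N + 1) * ε₁⁻¹ * Δ := by ring
        _ ≤ _ := by rw [← hc₂]; gcongr
    have hk : 0 ≤ a * (k / c) + c₂ := by positivity
    have h9 := mul_le_mul_of_nonneg_left hlen hk
    linarith

theorem sum_range_mul_eq_sum_sum {M : Type*} [AddCommMonoid M] (F : ℕ → M) (J m : ℕ) :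
    ∑ i ∈ Finset.range (J * m), F i =
      ∑ s ∈ Finset.range J, ∑ q ∈ Finset.range m, F (s + J * q) := by
  rw [Finset.sum_comm]
  induction m with
  | zero => simp
  | succ m ih =>
    rw [Finset.sum_range_succ, mul_add, mul_one, Finset.sum_range_add, ih]
    congr 1
    exact Finset.sum_congr rfl fun s _ => by rw [add_comm]

theorem exists_nonflat_sum_le {X : Type*} [NormedAddCommGroup X] [NormedSpace ℝ X] {p c : ℝ}
    (hp : 2 ≤ p) (hc : 0 < c) (hX : HasExcessBound X p c) {K ε₁ : ℝ} (hε₁ : 0 < ε₁)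
    (hε₁1 : ε₁ ≤ 1) :
    ∃ C : ℝ, 0 < C ∧ ∀ (γ : ℝ → X) (L : ℝ≥0), LipschitzWith L γ → ∀ ρ : ℝ, 0 < ρ →
      ∀ b : ℕ → X → ℝ, (∀ j x, 0 ≤ b j x) → (∀ j x, b j x ≤ 1) → ∀ T : ℕ → Finset X,
      (∀ j, ∀ x ∈ T j, x ∈ γ '' Icc 0 1) →
      (∀ j, ∀ x ∈ T j, ∀ y ∈ T j, x ≠ y → ρ * 2 ^ j ≤ dist x y) → ∀ n : ℕ,
      ∑ j ∈ Finset.range n, ∑ x ∈ T j with ¬ IsFlatAt γ K (ε₁ * b j x) (ρ * 2 ^ j) x,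
        b j x ^ p * (ρ * 2 ^ j) ≤ C * (L + ρ * 2 ^ n) := by
  obtain ⟨N, hN⟩ := exists_nat_ge (3 * (K + 2))
  obtain ⟨J, hJ⟩ := pow_unbounded_of_one_lt (60 * (2 * N + 2) : ℝ) one_lt_two
  have hN0 : (0 : ℝ) ≤ N := N.cast_nonneg
  have hJ0 : J ≠ 0 := by
    rintro rfl
    simp at hJ
    linarith
  set c₂ : ℝ := (2 * N + 1) * ε₁ ^ (-p) with hc₂
  set a : ℝ := 2 * c₂ * 2 ^ (p - 1) with ha
  set C₁ : ℝ := a * ((2 * N + 2) ^ (p - 1) / c) + c₂ with hC₁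
  have hc₂0 : 0 < c₂ := by positivity
  have ha0 : 0 < a := by positivity
  have hC₁0 : 0 < C₁ := by positivity
  refine ⟨J * (C₁ + (2 * N + 2) * 2 ^ (2 * J)), by positivity, ?_⟩
  intro γ L hγ ρ hρ b hb hb1 T hT hsep n
  have hJ1 : (1 : ℝ) < 2 ^ J := by linarith
  set F : ℕ → ℝ := fun j => ∑ x ∈ T j with ¬ IsFlatAt γ K (ε₁ * b j x) (ρ * 2 ^ j) x,
    b j x ^ p * (ρ * 2 ^ j) with hF
  have hF0 : ∀ j, 0 ≤ F j := fun j => Finset.sum_nonneg fun x _ => by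
    have := hb j x
    positivity
  set m := n / J + 1 with hm
  have hnm : n ≤ J * m := by
    rw [hm]; have := Nat.div_add_mod n J; have := Nat.mod_lt n (Nat.pos_of_ne_zero hJ0)
    rw [mul_add]; omega
  have hmn : J * m ≤ n + J := by
    rw [hm, mul_add]; have := Nat.div_add_mod n J; omega
  have key : ∀ s ∈ Finset.range J, ∑ q ∈ Finset.range m, F (s + J * q) ≤
      (C₁ + (2 * N + 2) * 2 ^ (2 * J)) * (L + ρ * 2 ^ n) := by
    intro s hs
    have hs := Finset.mem_range.1 hs
    have e : ∀ j, ρ * 2 ^ s * ((2 : ℝ) ^ J) ^ j = ρ * 2 ^ (s + J * j) := fun j => by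
      rw [pow_add, pow_mul, mul_assoc]
    obtain ⟨G, hG, -, h⟩ := exists_replaceGaps_of_levels hp hc hX hγ (K := K) (ε₁ := ε₁)
      (ρ := ρ * 2 ^ s) (Λ := 2 ^ J)
      (by positivity) hε₁ hε₁1 hN hJ.le (b := fun j => b (s + J * j)) (fun j => hb _)
      (fun j => hb1 _) (fun j => T (s + J * j)) (fun j => hT _)
      (fun j => by simp only [e]; exact hsep _) hc₂ ha m
    have h1 : ∑ j ∈ Finset.range m, ρ * 2 ^ s * ((2 : ℝ) ^ J) ^ j ≤ 2 ^ (2 * J) * (ρ * 2 ^ n) := by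
      rw [← Finset.mul_sum, geom_sum_eq hJ1.ne']
      have h2 : ((2 : ℝ) ^ J) ^ m ≤ 2 ^ (n + J) := by
        rw [← pow_mul]
        exact pow_le_pow_right₀ one_le_two hmn
      have h3 : (((2 : ℝ) ^ J) ^ m - 1) / (2 ^ J - 1) ≤ 2 ^ (n + J) := by
        rw [div_le_iff₀ (by linarith)]
        have : (0 : ℝ) < 2 ^ (n + J) := by positivity
        nlinarith
      have h3' : 0 ≤ (((2 : ℝ) ^ J) ^ m - 1) / (2 ^ J - 1) :=
        div_nonneg (sub_nonneg.2 (one_le_pow₀ hJ1.le)) (by linarith)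
      have h4 : (2 : ℝ) ^ s ≤ 2 ^ J := pow_le_pow_right₀ one_le_two hs.le
      calc _ ≤ ρ * 2 ^ J * 2 ^ (n + J) := by gcongr
        _ = _ := by ring
    have h5 : arcLen γ (Icc 0 1) 0 1 ≤ L := by simpa using arcLen_le (D := Icc 0 1) hγ zero_le_one
    have h6 : 0 ≤ C₁ * arcLen γ (gapCompl G) 0 1 := mul_nonneg hC₁0.le arcLen_nonneg
    have h7 : 0 ≤ a * ((ρ * 2 ^ s * ((2 : ℝ) ^ J) ^ m) ^ (1 - p) * gapEnergy γ p G) := by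
      have := gapEnergy_nonneg γ p G
      positivity
    have h8 : ∑ q ∈ Finset.range m, F (s + J * q) ≤ C₁ * arcLen γ (Icc 0 1) 0 1 +
        (2 * N + 2) * ∑ j ∈ Finset.range m, ρ * 2 ^ s * ((2 : ℝ) ^ J) ^ j := by
      simp only [hF, ← e]
      linarith
    have h9 : (2 * N + 2) * ∑ j ∈ Finset.range m, ρ * 2 ^ s * ((2 : ℝ) ^ J) ^ j ≤
        (2 * N + 2) * (2 ^ (2 * J) * (ρ * 2 ^ n)) := by gcongr
    have h10 := mul_le_mul_of_nonneg_left h5 hC₁0.le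
    have h11 : 0 ≤ C₁ * (ρ * 2 ^ n) := by positivity
    have h12 : 0 ≤ (2 * N + 2) * 2 ^ (2 * J) * (L : ℝ) := by positivity
    linarith
  calc ∑ j ∈ Finset.range n, F j ≤ ∑ j ∈ Finset.range (J * m), F j :=
        Finset.sum_le_sum_of_subset_of_nonneg (Finset.range_mono hnm) fun j _ _ => hF0 j
    _ = ∑ s ∈ Finset.range J, ∑ q ∈ Finset.range m, F (s + J * q) :=
        sum_range_mul_eq_sum_sum F J m
    _ ≤ ∑ s ∈ Finset.range J, (C₁ + (2 * N + 2) * 2 ^ (2 * J)) * (L + ρ * 2 ^ n) :=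
        Finset.sum_le_sum key
    _ = _ := by rw [Finset.sum_const, Finset.card_range, nsmul_eq_mul, mul_assoc]

/-- Every 1-Lipschitz image of a subset of `Γ` is controlled by the `m`-measure of the
`ε`-neighbourhood of that subset. -/
def DominatesImages {X : Type*} [PseudoMetricSpace X] [MeasurableSpace X] (Γ : Set X)
    (m : Measure X) (ε : ℝ) : Prop :=
  ∀ S ⊆ Γ, ∀ f : X → ℝ, LipschitzWith 1 f → volume (f '' S) ≤ m (cthickening ε S)

theorem dominatesImages_hausdorffMeasure {X : Type*} [MetricSpace X] [MeasurableSpace X]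
    [BorelSpace X] (Γ : Set X) : DominatesImages Γ ((μH[1] : Measure X).restrict Γ) 0 := by
  intro S hS f hf
  rw [cthickening_zero, Measure.restrict_apply measurableSet_closure]
  exact (volume_image_le_hausdorffMeasure hf S).trans
    (measure_mono (subset_inter subset_closure hS))

/-- Replace the mass of `m` in the sets `U x` by atoms at the points `x`. -/
def collapse {X : Type*} [MeasurableSpace X] (m : Measure X) (F : Finset X) (U : X → Set X)
    (w : X → ℝ) : Measure X :=
  m.restrict (⋃ x ∈ F, U x)ᶜ + ∑ x ∈ F, ENNReal.ofReal (w x) • Measure.dirac x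

theorem DominatesImages.collapse {X : Type*} [MetricSpace X] [MeasurableSpace X] [BorelSpace X]
    {Γ : Set X} {m : Measure X} {ε ε' : ℝ} (h : DominatesImages Γ m ε) (hε : 0 ≤ ε)
    {F : Finset X} {U : X → Set X} {d : X → ℝ} (hU : ∀ x ∈ F, U x ⊆ ball x (d x))
    (hε' : ε ≤ ε') (hd : ∀ x ∈ F, d x + ε ≤ ε') :
    DominatesImages Γ (collapse m F U fun x => 2 * (d x + ε)) ε' := by
  intro S hS f hf
  set F' := F.filter fun x => ∃ s ∈ S, dist s x < d x + ε with hF'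
  set S' := S \ ⋃ x ∈ F', ball x (d x + ε) with hS'
  have hS'S : S' ⊆ S := sdiff_subset
  have hdisj : cthickening ε S' ⊆ (⋃ x ∈ F, U x)ᶜ := by
    intro u hu hmem
    obtain ⟨x, hx, hux⟩ := mem_iUnion₂.1 hmem
    have hux := mem_ball.1 (hU x hx hux)
    have h1 : u ∈ thickening (ε + (d x - dist u x)) S' :=
      cthickening_subset_thickening' (by linarith) (by linarith) _ hu
    obtain ⟨s, hs, hus⟩ := mem_thickening_iff.1 h1
    have h2 : dist s x < d x + ε := by
      have := dist_triangle s u x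
      rw [dist_comm s u] at this
      linarith
    exact hs.2 (mem_iUnion₂.2 ⟨x, Finset.mem_filter.2 ⟨hx, s, hS'S hs, h2⟩, h2⟩)
  have hcover : f '' S ⊆ f '' S' ∪ ⋃ x ∈ F', ball (f x) (d x + ε) := by
    rintro _ ⟨s, hs, rfl⟩
    by_cases hsU : s ∈ ⋃ x ∈ F', ball x (d x + ε)
    · obtain ⟨x, hx, hsx⟩ := mem_iUnion₂.1 hsU
      refine Or.inr (mem_iUnion₂.2 ⟨x, hx, ?_⟩)
      have := hf.dist_le_mul s x
      rw [NNReal.coe_one, one_mul] at this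
      exact this.trans_lt hsx
    · exact Or.inl ⟨s, ⟨hs, hsU⟩, rfl⟩
  have hmeas : MeasurableSet (cthickening ε' S) := isClosed_cthickening.measurableSet
  have hdirac : ∀ x ∈ F', Measure.dirac x (cthickening ε' S) = 1 := by
    intro x hx
    obtain ⟨hxF, s, hs, hsx⟩ := Finset.mem_filter.1 hx
    rw [Measure.dirac_apply' _ hmeas, indicator_of_mem]
    · rfl
    · refine mem_cthickening_of_dist_le x s ε' S hs ?_
      rw [dist_comm]
      linarith [hd x hxF]
  calc volume (f '' S) ≤ volume (f '' S' ∪ ⋃ x ∈ F', ball (f x) (d x + ε)) := measure_mono hcover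
    _ ≤ volume (f '' S') + ∑ x ∈ F', volume (ball (f x) (d x + ε)) :=
        (measure_union_le _ _).trans (by gcongr; exact measure_biUnion_finset_le _ _)
    _ ≤ m.restrict (⋃ x ∈ F, U x)ᶜ (cthickening ε' S) +
        ∑ x ∈ F, ENNReal.ofReal (2 * (d x + ε)) * Measure.dirac x (cthickening ε' S) := by
        gcongr ?_ + ?_
        · calc volume (f '' S') ≤ m (cthickening ε S') := h S' (hS'S.trans hS) f hf
            _ = m.restrict (⋃ x ∈ F, U x)ᶜ (cthickening ε S') := by
              rw [Measure.restrict_apply isClosed_cthickening.measurableSet,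
                inter_eq_left.2 hdisj]
            _ ≤ _ := measure_mono ((cthickening_subset_of_subset _ hS'S).trans
                (cthickening_mono hε' _))
        · calc ∑ x ∈ F', volume (ball (f x) (d x + ε)) =
              ∑ x ∈ F', ENNReal.ofReal (2 * (d x + ε)) * Measure.dirac x (cthickening ε' S) :=
              Finset.sum_congr rfl fun x hx => by rw [hdirac x hx, Real.volume_ball, mul_one]
            _ ≤ _ := Finset.sum_le_sum_of_subset (Finset.filter_subset _ _)
    _ = _ := by simp [_root_.collapse]

theorem collapse_real_univ {X : Type*} [MeasurableSpace X] {m : Measure X} [IsFiniteMeasure m]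
    {F : Finset X} {U : X → Set X} {w : X → ℝ} (hU : ∀ x ∈ F, MeasurableSet (U x))
    (hd : (F : Set X).PairwiseDisjoint U) (hw : ∀ x ∈ F, 0 ≤ w x) :
    IsFiniteMeasure (collapse m F U w) ∧
    (collapse m F U w).real univ = m.real univ - ∑ x ∈ F, (m.real (U x) - w x) := by
  have hUm : MeasurableSet (⋃ x ∈ F, U x) := F.measurableSet_biUnion hU
  have h1 : collapse m F U w univ =
      m (⋃ x ∈ F, U x)ᶜ + ∑ x ∈ F, ENNReal.ofReal (w x) := by
    simp [collapse]
  refine ⟨⟨?_⟩, ?_⟩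
  · rw [h1]
    exact ENNReal.add_lt_top.2 ⟨measure_lt_top _ _, ENNReal.sum_lt_top.2 fun _ _ => by simp⟩
  · rw [measureReal_def, h1, ENNReal.toReal_add (measure_ne_top _ _)
      (ENNReal.sum_lt_top.2 fun _ _ => by simp).ne, ENNReal.toReal_sum (fun _ _ => by simp),
      ← measureReal_def, measureReal_compl hUm, measureReal_biUnion_finset hd hU,
      Finset.sum_sub_distrib]
    rw [Finset.sum_congr rfl fun x hx => ENNReal.toReal_ofReal (hw x hx)]
    ring

section FlatArc
variable {X : Type*} [NormedAddCommGroup X] [NormedSpace ℝ X]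

theorem exists_line_coordinate {P Q z : X} {h : ℝ} (hh : 0 < h)
    (hz : infDist z (segment ℝ P Q) ≤ h) :
    ∃ t ∈ Icc (0 : ℝ) 1, dist z (P + t • (Q - P)) < 2 * h := by
  have hne : (segment ℝ P Q).Nonempty := ⟨P, left_mem_segment ℝ P Q⟩
  obtain ⟨w, hw, hzw⟩ := (infDist_lt_iff hne).1 (hz.trans_lt (show h < 2 * h by linarith))
  rw [segment_eq_image'] at hw
  obtain ⟨t, ht, rfl⟩ := hw
  exact ⟨t, ht, hzw⟩

/-- A norming functional for `Q - P` is nearly isometric near the segment `[P, Q]`. -/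
theorem exists_near_isometry {P Q : X} (hPQ : P ≠ Q) :
    ∃ f : X → ℝ, LipschitzWith 1 f ∧ Continuous f ∧ f P = 0 ∧ f Q = dist P Q ∧
      (∀ h, 0 < h → ∀ z, infDist z (segment ℝ P Q) ≤ h → -(2 * h) ≤ f z ∧ f z ≤ dist P Q + 2 * h) ∧
      ∀ h, 0 < h → ∀ z w, infDist z (segment ℝ P Q) ≤ h → infDist w (segment ℝ P Q) ≤ h →
        dist z w ≤ |f z - f w| + 8 * h := by
  obtain ⟨g, hg1, hg⟩ := exists_dual_vector ℝ (Q - P) (norm_ne_zero_iff.2 (sub_ne_zero.2 hPQ.symm))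
  have hlip : LipschitzWith 1 (fun z => g z - g P) := by
    refine LipschitzWith.of_dist_le_mul fun x y => ?_
    rw [Real.dist_eq, sub_sub_sub_cancel_right, ← map_sub, dist_eq_norm, ← Real.norm_eq_abs]
    simpa [hg1] using g.le_opNorm (x - y)
  refine ⟨fun z => g z - g P, hlip, hlip.continuous, sub_self _, ?_, ?_, ?_⟩
  · show g Q - g P = _
    rw [← map_sub, hg, dist_comm, dist_eq_norm]
    simp
  · intro h hh z hz
    obtain ⟨t, ht, hzt⟩ := exists_line_coordinate hh hz
    have hgQP : g Q - g P = dist P Q := by rw [← map_sub, hg, dist_comm, dist_eq_norm]; simp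
    have h1 := hlip.dist_le_mul z (P + t • (Q - P))
    simp only [Real.dist_eq, map_add, map_smul, map_sub, smul_eq_mul, hgQP, NNReal.coe_one,
      one_mul] at h1
    have h2 := mul_nonneg ht.1 (dist_nonneg (x := P) (y := Q))
    have h3 := mul_le_mul_of_nonneg_right ht.2 (dist_nonneg (x := P) (y := Q))
    rw [abs_le] at h1
    constructor <;> linarith [h1.1, h1.2]
  · intro h hh z w hz hw
    obtain ⟨t, ht, hzt⟩ := exists_line_coordinate hh hz
    obtain ⟨s, hs, hws⟩ := exists_line_coordinate hh hw
    have hgQP : g Q - g P = ‖Q - P‖ := by rw [← map_sub, hg]; simp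
    have h1 := hlip.dist_le_mul z (P + t • (Q - P))
    have h2 := hlip.dist_le_mul w (P + s • (Q - P))
    simp only [Real.dist_eq, map_add, map_smul, map_sub, smul_eq_mul, hgQP, NNReal.coe_one,
      one_mul] at h1 h2
    have h3 : dist (P + t • (Q - P)) (P + s • (Q - P)) = |t * ‖Q - P‖ - s * ‖Q - P‖| := by
      rw [dist_add_left, dist_eq_norm, ← sub_smul, norm_smul, Real.norm_eq_abs, ← sub_mul, abs_mul,
        abs_norm]
    have h4 : dist z w ≤ dist z (P + t • (Q - P)) + dist (P + t • (Q - P)) (P + s • (Q - P)) +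
        dist w (P + s • (Q - P)) := by
      rw [dist_comm w]; exact dist_triangle4 _ _ _ _
    have h5 : |t * ‖Q - P‖ - s * ‖Q - P‖| ≤ |(g z - g P) - (g w - g P)| + 4 * h := by
      rw [abs_le] at h1 h2 ⊢
      rcases abs_cases ((g z - g P) - (g w - g P)) with ⟨e, _⟩ | ⟨e, _⟩ <;>
        rw [e] <;> constructor <;> linarith [h1.1, h1.2, h2.1, h2.2]
    rw [h3] at h4
    linarith

theorem infDist_lineThrough_le_infDist_segment {P Q z : X} {h : ℝ} (hh : 0 < h)
    (hz : infDist z (segment ℝ P Q) ≤ h) : infDist z (lineThrough P (Q - P)) ≤ 2 * h := by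
  obtain ⟨t, -, hzt⟩ := exists_line_coordinate hh hz
  exact (infDist_le_dist_of_mem
    (show P + t • (Q - P) ∈ lineThrough P (Q - P) from ⟨t, rfl⟩)).trans hzt.le

end FlatArc

section FlatMass
variable {X : Type*} [NormedAddCommGroup X] [NormedSpace ℝ X] [MeasurableSpace X]

/-- Near a point at which `γ` is flat, `Γ` cannot have length much smaller than a quarter radius. -/
theorem IsFlatAt.measure_ball_ge {γ : ℝ → X} (hγ : Continuous γ) {m : Measure X}
    [IsFiniteMeasure m] {ε K η r β : ℝ} {x : X} (hm : DominatesImages (γ '' Icc 0 1) m ε)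
    (hr : 0 < r) (hβ1 : β ≤ 1) (hK : 1 ≤ K) (hε : ε ≤ β / 400 * r)
    (hx : IsFlatAt γ K η r x) : r / 5 ≤ m.real (ball x (r / 4)) := by
  obtain ⟨a, b, t, ha, hb, ht, rfl, hda, -, -⟩ := hx
  have hconn : IsPreconnected (γ '' Icc 0 1) := isPreconnected_Icc.image _ hγ.continuousOn
  have hab : a ≤ b := ht.1.trans ht.2
  have h1 := ofReal_le_volume_image_dist hconn (v := γ t) (z := γ a) (r := r / 4 - 2 * (r / 400))
    (mem_image_of_mem _ ⟨ha.trans ht.1, ht.2.trans hb⟩) (mem_image_of_mem _ ⟨ha, hab.trans hb⟩)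
    (by rw [dist_comm]; nlinarith)
  have hε' : ε ≤ r / 400 := by nlinarith
  have h2 := h1.trans (hm _ inter_subset_left _ (LipschitzWith.dist_left (γ t)))
  have h3 : cthickening ε (γ '' Icc 0 1 ∩ ball (γ t) (r / 4 - 2 * (r / 400))) ⊆
      ball (γ t) (r / 4) := by
    intro u hu
    obtain ⟨s, hs, hus⟩ := mem_thickening_iff.1 (cthickening_subset_thickening'
      (show 0 < 2 * (r / 400) by positivity) (by linarith) _ hu)
    have := mem_ball.1 hs.2
    rw [mem_ball]
    linarith [dist_triangle u s (γ t)]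
  have h4 := h2.trans (measure_mono h3)
  have h5 := (ENNReal.ofReal_le_iff_le_toReal (measure_ne_top _ _)).1 h4
  rw [measureReal_def]
  linarith

/-- A flat arc through `x` together with a point of `Γ` far from its chord carries more mass
than a segment. -/
theorem IsFlatAt.excess_mass [BorelSpace X] {γ : ℝ → X} (hγ : Continuous γ) {m : Measure X}
    [IsFiniteMeasure m] {ε η A r β : ℝ} {x : X} (hm : DominatesImages (γ '' Icc 0 1) m ε)
    (hr : 0 < r) (hA : 0 ≤ A) (hβ : 0 < β) (hβ1 : β ≤ 1) (hη : η ≤ β / 400)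
    (hε : ε ≤ β / 400 * r)
    (hx : IsFlatAt γ (A + 2) η r x)
    (hfar : ∀ a v : X, v ≠ 0 → ∃ y ∈ γ '' Icc 0 1, dist y x ≤ A * r ∧
      β * r ≤ infDist y (lineThrough a v)) :
    2 * ((A + 2) * r + ε) + β * r / 16 ≤ m.real (ball x ((A + 2) * r)) := by
  obtain ⟨a, b, t, ha, hb, ht, rfl, hda, hdb, hflat⟩ := hx
  have hconn : IsPreconnected (γ '' Icc 0 1) := isPreconnected_Icc.image _ hγ.continuousOn
  have hab : a ≤ b := ht.1.trans ht.2
  set h := β / 400 * r with hh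
  have hh0 : 0 < h := by positivity
  have hflat' : ∀ s ∈ Icc a b, infDist (γ s) (segment ℝ (γ a) (γ b)) ≤ h := fun s hs =>
    (hflat s hs).trans (by rw [hh]; gcongr)
  have hβr : β * r = 400 * h := by rw [hh]; ring
  have hhr : 400 * h ≤ r := by rw [← hβr]; nlinarith
  have hAr : 0 ≤ A * r := by positivity
  have hPQ : γ a ≠ γ b := by
    intro he
    have := hflat' t ht
    rw [he, segment_same, infDist_singleton] at this
    nlinarith
  obtain ⟨y, hyΓ, hyx, hyl⟩ := hfar (γ a) (γ b - γ a) (sub_ne_zero.2 hPQ.symm)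
  obtain ⟨f, hf, hfc, hfP, hfQ, hfr, hiso⟩ := exists_near_isometry hPQ
  have hxΓ : γ t ∈ γ '' Icc 0 1 := mem_image_of_mem _ ⟨ha.trans ht.1, ht.2.trans hb⟩
  have hsegP : infDist (γ a) (segment ℝ (γ a) (γ b)) ≤ h := hflat' a ⟨le_rfl, hab⟩
  have hsegQ : infDist (γ b) (segment ℝ (γ a) (γ b)) ≤ h := hflat' b ⟨hab, le_rfl⟩
  set ρ := (A + 2) * r - 10 * h with hρ
  have hρ0 : 0 ≤ ρ := by rw [hρ]; nlinarith
  have hcoord : ρ ≤ f (γ t) ∧ ρ ≤ dist (γ a) (γ b) - f (γ t) := by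
    have h1 := hiso h hh0 _ _ (hflat' t ht) hsegP
    have h2 := hiso h hh0 _ _ (hflat' t ht) hsegQ
    have h3 := hfr h hh0 _ (hflat' t ht)
    rw [hfP, sub_zero] at h1
    rw [hfQ] at h2
    constructor
    · rcases abs_cases (f (γ t)) with ⟨e, _⟩ | ⟨e, _⟩ <;> rw [e] at h1 <;> linarith [h3.1]
    · rcases abs_cases (f (γ t) - dist (γ a) (γ b)) with ⟨e, _⟩ | ⟨e, _⟩ <;> rw [e] at h2 <;>
        linarith [h3.2]
  set S₁ : Set X := γ '' {s ∈ Icc a b | |f (γ s) - f (γ t)| ≤ ρ} with hS₁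
  set S₂ : Set X := γ '' Icc 0 1 ∩ ball y (β * r / 8) with hS₂
  have hS₁Γ : S₁ ⊆ γ '' Icc 0 1 := image_mono fun s hs => ⟨ha.trans hs.1.1, hs.1.2.trans hb⟩
  have hv₁ : ENNReal.ofReal (2 * ρ) ≤ m (cthickening ε S₁) := by
    refine le_trans ?_ (hm S₁ hS₁Γ f hf)
    have hsub : Icc (f (γ t) - ρ) (f (γ t) + ρ) ⊆ f '' S₁ := by
      intro u hu
      have hcont : ContinuousOn (fun s => f (γ s)) (Icc a b) := (hfc.comp hγ).continuousOn
      obtain ⟨s, hs, hsu⟩ := intermediate_value_Icc hab hcont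
        (show u ∈ Icc (f (γ a)) (f (γ b)) by
          rw [hfP, hfQ]
          exact ⟨by linarith [hu.1, hcoord.1], by linarith [hu.2, hcoord.2]⟩)
      refine ⟨γ s, ⟨s, ⟨hs, ?_⟩, rfl⟩, hsu⟩
      have hsu : f (γ s) = u := hsu
      rw [hsu, abs_le]
      exact ⟨by linarith [hu.1], by linarith [hu.2]⟩
    calc ENNReal.ofReal (2 * ρ) = volume (Icc (f (γ t) - ρ) (f (γ t) + ρ)) := by
          rw [Real.volume_Icc]; ring_nf
      _ ≤ _ := measure_mono hsub
  have hxl : infDist (γ t) (lineThrough (γ a) (γ b - γ a)) ≤ 2 * h :=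
    infDist_lineThrough_le_infDist_segment hh0 (hflat' t ht)
  have hv₂ : ENNReal.ofReal (β * r / 8) ≤ m (cthickening ε S₂) := by
    refine le_trans ?_ (hm S₂ inter_subset_left _ (LipschitzWith.dist_left y))
    refine ofReal_le_volume_image_dist hconn hyΓ hxΓ ?_
    have := infDist_le_infDist_add_dist (s := lineThrough (γ a) (γ b - γ a)) (x := y) (y := γ t)
    rw [dist_comm]
    linarith
  have hthick : ∀ S : Set X, ∀ u ∈ cthickening ε S, ∃ s ∈ S, dist u s < 2 * h := fun S u hu =>
    mem_thickening_iff.1 (cthickening_subset_thickening' (by positivity) (by linarith) _ hu)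
  have hb₁ : cthickening ε S₁ ⊆ ball (γ t) ((A + 2) * r) := by
    intro u hu
    obtain ⟨_, ⟨s, hs, rfl⟩, hus⟩ := hthick _ u hu
    have h1 := hiso h hh0 _ _ (hflat' s hs.1) (hflat' t ht)
    rw [mem_ball]
    have hs2 : |f (γ s) - f (γ t)| ≤ ρ := hs.2
    linarith [dist_triangle u (γ s) (γ t)]
  have hb₂ : cthickening ε S₂ ⊆ ball (γ t) ((A + 2) * r) := by
    intro u hu
    obtain ⟨s, hs, hus⟩ := hthick _ u hu
    have h1 := mem_ball.1 hs.2
    rw [mem_ball]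
    linarith [dist_triangle4 u s y (γ t)]
  have hdisj : Disjoint (cthickening ε S₁) (cthickening ε S₂) := by
    refine disjoint_left.2 fun u hu₁ hu₂ => ?_
    obtain ⟨_, ⟨s, hs, rfl⟩, hus⟩ := hthick _ u hu₁
    obtain ⟨z, hz, huz⟩ := hthick _ u hu₂
    have h1 := mem_ball.1 hz.2
    have h2 : infDist (γ s) (lineThrough (γ a) (γ b - γ a)) ≤ 2 * h :=
      infDist_lineThrough_le_infDist_segment hh0 (hflat' s hs.1)
    have h3 := infDist_le_infDist_add_dist (s := lineThrough (γ a) (γ b - γ a)) (x := y) (y := γ s)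
    have h4 := dist_triangle4 y z u (γ s)
    rw [dist_comm y z, dist_comm z u] at h4
    linarith
  have hsum : ENNReal.ofReal (2 * ρ) + ENNReal.ofReal (β * r / 8) ≤
      m (ball (γ t) ((A + 2) * r)) :=
    calc _ ≤ m (cthickening ε S₁) + m (cthickening ε S₂) := add_le_add hv₁ hv₂
      _ = m (cthickening ε S₁ ∪ cthickening ε S₂) :=
        (measure_union hdisj isClosed_cthickening.measurableSet).symm
      _ ≤ _ := measure_mono (union_subset hb₁ hb₂)
  rw [← ENNReal.ofReal_add (by positivity) (by positivity)] at hsum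
  have := (ENNReal.ofReal_le_iff_le_toReal (measure_ne_top _ _)).1 hsum
  rw [measureReal_def]
  linarith

end FlatMass

theorem exists_nearest_separated {X : Type*} [PseudoMetricSpace X] (T : Finset X) {R : ℝ}
    (hR : 0 < R) :
    ∃ F ⊆ T, (∀ x ∈ F, ∀ y ∈ F, x ≠ y → R ≤ dist x y) ∧
      ∃ φ : X → X, ∀ x ∈ T, φ x ∈ F ∧ dist x (φ x) < R ∧ ∀ y ∈ F, dist x (φ x) ≤ dist x y := by
  set S := T.powerset.filter fun F => ∀ x ∈ F, ∀ y ∈ F, x ≠ y → R ≤ dist x y with hS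
  obtain ⟨F, hF, hmax⟩ := S.exists_max_image Finset.card ⟨∅, by simp [hS]⟩
  obtain ⟨hFT, hsep⟩ := Finset.mem_filter.1 hF
  have hFT := Finset.mem_powerset.1 hFT
  have hcov : ∀ x ∈ T, ∃ y ∈ F, dist x y < R := by
    intro x hx
    by_contra! hfar
    have hxF : x ∉ F := fun h => by
      have := hfar x h
      rw [dist_self] at this
      linarith
    have := hmax (insert x F) (Finset.mem_filter.2 ⟨Finset.mem_powerset.2
      (Finset.insert_subset hx hFT), by
        intro u hu v hv huv
        rcases Finset.mem_insert.1 hu with rfl | hu' <;>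
          rcases Finset.mem_insert.1 hv with rfl | hv'
        · exact absurd rfl huv
        · exact hfar v hv'
        · rw [dist_comm]; exact hfar u hu'
        · exact hsep u hu' v hv' huv⟩)
    rw [Finset.card_insert_of_notMem hxF] at this
    omega
  refine ⟨F, hFT, hsep, ?_⟩
  have : ∀ x, ∃ z, x ∈ T → z ∈ F ∧ dist x z < R ∧ ∀ y ∈ F, dist x z ≤ dist x y := by
    intro x
    by_cases hx : x ∈ T
    · obtain ⟨y, hy, hxy⟩ := hcov x hx
      obtain ⟨z, hz, hmin⟩ := F.exists_min_image (fun z => dist x z) ⟨y, hy⟩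
      exact ⟨z, fun _ => ⟨hz, (hmin y hy).trans_lt hxy, hmin⟩⟩
    · exact ⟨x, fun h => absurd h hx⟩
  choose φ hφ using this
  exact ⟨φ, hφ⟩

theorem DominatesImages.exists_of_excess {X : Type*} [MetricSpace X] [MeasurableSpace X]
    [BorelSpace X] {Γ : Set X} {m : Measure X} [IsFiniteMeasure m] {ε A r β : ℝ}
    (hm : DominatesImages Γ m ε) (hr : 0 < r) (hA : 0 ≤ A) (hβ1 : β ≤ 1)
    (hε0 : 0 ≤ ε) (hε : ε ≤ r) {n : ℕ} (hn : 40 * (A + 4) ≤ n) (T : Finset X)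
    (hsep : ∀ x ∈ T, ∀ y ∈ T, x ≠ y → r ≤ dist x y)
    (hmass : ∀ x ∈ T, r / 5 ≤ m.real (ball x (r / 4)))
    (hexc : ∀ x ∈ T, 2 * ((A + 2) * r + ε) + β * r / 16 ≤ m.real (ball x ((A + 2) * r)))
    (hβ : 0 < β) :
    ∃ m' : Measure X, IsFiniteMeasure m' ∧ DominatesImages Γ m' ((2 * A + 8) * r) ∧
      m'.real univ + T.card * (β * r / (16 * n)) ≤ m.real univ := by
  have hAr : 0 ≤ A * r := by positivity
  have hn1 : (1 : ℝ) ≤ n := by linarith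
  obtain ⟨F, hFT, hFsep, φ, hφ⟩ := exists_nearest_separated T
    (show 0 < 2 * ((A + 2) * r) + 2 * r by positivity)
  set Cl : X → Finset X := fun x => T.filter fun z => φ z = x with hCl
  have hCl_mem : ∀ {x z}, z ∈ Cl x → z ∈ T ∧ φ z = x := fun h => Finset.mem_filter.1 h
  set U : X → Set X := fun x => if (Cl x).card ≤ n then ball x ((A + 2) * r)
    else ⋃ z ∈ Cl x, ball z (r / 4) with hU
  set d : X → ℝ := fun x => if (Cl x).card ≤ n then (A + 2) * r
    else 2 * ((A + 2) * r) + 2 * r + r / 4 with hd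
  have hUd : ∀ x ∈ F, U x ⊆ ball x (d x) := by
    intro x _
    simp only [hU, hd]
    split_ifs
    · rfl
    · refine iUnion₂_subset fun z hz u hu => ?_
      have h1 := hφ z (hCl_mem hz).1
      rw [(hCl_mem hz).2] at h1
      rw [mem_ball] at hu ⊢
      linarith [dist_triangle u z x, h1.2.1]
  have hd0 : ∀ x, 0 ≤ d x := by
    intro x
    simp only [hd]
    split_ifs <;> positivity
  have hdle : ∀ x ∈ F, d x + ε ≤ (2 * A + 8) * r := by
    intro x _
    simp only [hd]
    split_ifs <;> linarith
  have hUmeas : ∀ x ∈ F, MeasurableSet (U x) := by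
    intro x _
    simp only [hU]
    split_ifs
    · exact measurableSet_ball
    · exact Finset.measurableSet_biUnion _ fun _ _ => measurableSet_ball
  have hUcases : ∀ x u, u ∈ U x → dist u x < (A + 2) * r ∨ ∃ z ∈ Cl x, dist u z < r / 4 := by
    intro x u hu
    simp only [hU] at hu
    split_ifs at hu
    · exact Or.inl hu
    · simpa using Or.inr hu
  have hmixed : ∀ x ∈ F, ∀ y ∈ F, x ≠ y → ∀ u, dist u x < (A + 2) * r →
      ∀ z ∈ Cl y, r / 4 ≤ dist u z := by
    intro x hx y hy hxy u hux z hz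
    by_contra! hlt
    have h1 := hφ z (hCl_mem hz).1
    rw [(hCl_mem hz).2] at h1
    have h2 := h1.2.2 x hx
    have h3 := dist_triangle z u x
    have h4 := hFsep x hx y hy hxy
    have h5 := dist_triangle x z y
    rw [dist_comm z u] at h3
    rw [dist_comm x z] at h5
    linarith
  have hdisj : (F : Set X).PairwiseDisjoint U := by
    intro x hx y hy hxy
    refine disjoint_left.2 fun u hux huy => ?_
    rcases hUcases x u hux with h | ⟨z, hz, h⟩ <;> rcases hUcases y u huy with h' | ⟨w, hw, h'⟩
    · have := hFsep x hx y hy hxy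
      have h3 := dist_triangle x u y
      rw [dist_comm x u] at h3
      linarith
    · linarith [hmixed x hx y hy hxy u h w hw]
    · linarith [hmixed y hy x hx (Ne.symm hxy) u h' z hz]
    · have hzw : z ≠ w := by
        rintro rfl
        exact hxy ((hCl_mem hz).2.symm.trans (hCl_mem hw).2)
      have h3 := hsep z (hCl_mem hz).1 w (hCl_mem hw).1 hzw
      have h4 := dist_triangle z u w
      rw [dist_comm z u] at h4
      linarith
  have hgain : ∀ x ∈ F, (Cl x).card * (β * r / (16 * n)) ≤ m.real (U x) - 2 * (d x + ε) := by
    intro x hx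
    have hβr : β * r ≤ r := by nlinarith
    simp only [hU, hd]
    split_ifs with hcard
    · have hcard : ((Cl x).card : ℝ) ≤ n := by exact_mod_cast hcard
      have h1 := hexc x (hFT hx)
      have h2 : (Cl x).card * (β * r / (16 * n)) ≤ n * (β * r / (16 * n)) := by gcongr
      have h3 : n * (β * r / (16 * n)) = β * r / 16 := by field_simp
      linarith
    · have hcard : (n : ℝ) ≤ (Cl x).card := by
        push Not at hcard
        exact_mod_cast hcard.le
      have hdj : ((Cl x : Finset X) : Set X).PairwiseDisjoint fun z => ball z (r / 4) := by
        intro z hz w hw hzw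
        refine ball_disjoint_ball ?_
        linarith [hsep z (hCl_mem hz).1 w (hCl_mem hw).1 hzw]
      rw [measureReal_biUnion_finset hdj fun _ _ => measurableSet_ball]
      have h1 : (Cl x).card * (r / 5) ≤ ∑ z ∈ Cl x, m.real (ball z (r / 4)) := by
        rw [← nsmul_eq_mul]
        exact Finset.card_nsmul_le_sum _ _ _ fun z hz => hmass z (hCl_mem hz).1
      have h2 : β * r / (16 * n) ≤ r / 16 :=
        div_le_div₀ hr.le hβr (by norm_num) (by linarith)
      have h3 : (Cl x).card * (β * r / (16 * n)) ≤ (Cl x).card * (r / 16) := by gcongr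
      have h4 : 40 * (A + 4) * r ≤ (Cl x).card * r := by
        gcongr
        linarith
      linarith
  obtain ⟨hfin, hreal⟩ := collapse_real_univ (m := m) (w := fun x => 2 * (d x + ε)) hUmeas hdisj
    fun x _ => by have := hd0 x; positivity
  refine ⟨_, hfin, hm.collapse hε0 hUd (by nlinarith) hdle, ?_⟩
  have hcard : (T.card : ℝ) = ∑ x ∈ F, ((Cl x).card : ℝ) := by
    rw [Finset.card_eq_sum_card_fiberwise (f := φ) (t := F) fun x hx => (hφ x hx).1]
    push_cast
    rfl
  rw [hreal, hcard, Finset.sum_mul]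
  linarith [Finset.sum_le_sum hgain]

theorem DominatesImages.mono {X : Type*} [PseudoMetricSpace X] [MeasurableSpace X] {Γ : Set X}
    {m : Measure X} {ε ε' : ℝ} (h : DominatesImages Γ m ε) (hε : ε ≤ ε') :
    DominatesImages Γ m ε' :=
  fun S hS f hf => (h S hS f hf).trans (measure_mono (cthickening_mono hε S))

/-- `Γ` contains a point in `closedBall x R` at distance at least `δ` from any given line. -/
def IsFarFromLines {X : Type u} [NormedAddCommGroup X] [NormedSpace ℝ X] (Γ : Set X) (x : X)
    (R δ : ℝ) : Prop :=
  ∀ a v : X, v ≠ 0 → ∃ y ∈ Γ, dist y x ≤ R ∧ δ ≤ infDist y (lineThrough a v)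

section FlatSum
variable {X : Type u} [NormedAddCommGroup X] [NormedSpace ℝ X] [MeasurableSpace X] [BorelSpace X]

theorem exists_dominatesImages_of_flat_levels {γ : ℝ → X} (hγ : Continuous γ)
    (hH : μH[1] (γ '' Icc 0 1) < ⊤) {A β ρ Λ : ℝ} (hρ : 0 < ρ) (hA : 0 ≤ A) (hβ : 0 < β)
    (hβ1 : β ≤ 1) (hΛ : 400 * (2 * A + 8) ≤ β * Λ) {n : ℕ} (hn : 40 * (A + 4) ≤ n)
    (T : ℕ → Finset X)
    (hsep : ∀ j, ∀ x ∈ T j, ∀ y ∈ T j, x ≠ y → ρ * Λ ^ j ≤ dist x y)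
    (hflat : ∀ j, ∀ x ∈ T j, ∃ η ≤ β / 400, IsFlatAt γ (A + 2) η (ρ * Λ ^ j) x)
    (hfar : ∀ j, ∀ x ∈ T j, IsFarFromLines (γ '' Icc 0 1) x (A * (ρ * Λ ^ j)) (β * (ρ * Λ ^ j)))
    (k : ℕ) :
    ∃ m : Measure X, IsFiniteMeasure m ∧
      DominatesImages (γ '' Icc 0 1) m (β / 400 * (ρ * Λ ^ k)) ∧
      m.real univ + ∑ j ∈ Finset.range k, (T j).card * (β * (ρ * Λ ^ j) / (16 * n)) ≤
        (μH[1] (γ '' Icc 0 1)).toReal := by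
  have hΛ0 : 0 < Λ := by
    by_contra! h
    nlinarith
  induction k with
  | zero =>
    refine ⟨(μH[1] : Measure X).restrict (γ '' Icc 0 1), ⟨by simpa using hH⟩,
      (dominatesImages_hausdorffMeasure _).mono (by positivity), ?_⟩
    simp [measureReal_def]
  | succ k ih =>
    obtain ⟨m, hfin, hm, hle⟩ := ih
    have hr : 0 < ρ * Λ ^ k := by positivity
    obtain ⟨m', hfin', hm', hle'⟩ := hm.exists_of_excess hr hA hβ1 (by positivity)
      (by nlinarith) hn (T k) (hsep k)
      (fun x hx => by
        obtain ⟨η, -, h⟩ := hflat k x hx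
        exact h.measure_ball_ge hγ hm hr hβ1 (by linarith) le_rfl)
      (fun x hx => by
        obtain ⟨η, hη, h⟩ := hflat k x hx
        exact h.excess_mass hγ hm hr hA hβ hβ1 hη le_rfl (hfar k x hx)) hβ
    refine ⟨m', hfin', hm'.mono ?_, ?_⟩
    · rw [pow_succ]
      nlinarith
    · rw [Finset.sum_range_succ]
      linarith

theorem flat_sum_le {γ : ℝ → X} (hγ : Continuous γ)
    (hH : μH[1] (γ '' Icc 0 1) < ⊤) {A β ρ : ℝ} (hρ : 0 < ρ) (hA : 0 ≤ A) (hβ : 0 < β)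
    (hβ1 : β ≤ 1) {J : ℕ} (hJ : 400 * (2 * A + 8) ≤ β * 2 ^ J) {n : ℕ} (hn : 40 * (A + 4) ≤ n)
    (T : ℕ → Finset X)
    (hsep : ∀ j, ∀ x ∈ T j, ∀ y ∈ T j, x ≠ y → ρ * 2 ^ j ≤ dist x y)
    (hflat : ∀ j, ∀ x ∈ T j, ∃ η ≤ β / 400, IsFlatAt γ (A + 2) η (ρ * 2 ^ j) x)
    (hfar : ∀ j, ∀ x ∈ T j, IsFarFromLines (γ '' Icc 0 1) x (A * (ρ * 2 ^ j)) (β * (ρ * 2 ^ j)))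
    (k : ℕ) :
    ∑ j ∈ Finset.range k, (T j).card * (ρ * 2 ^ j) ≤
      16 * n * J * β⁻¹ * (μH[1] (γ '' Icc 0 1)).toReal := by
  have hn0 : (0 : ℝ) < n := by linarith
  have hJ0 : J ≠ 0 := by
    rintro rfl
    simp at hJ
    linarith
  have hkJ : k ≤ J * k := Nat.le_mul_of_pos_left k (Nat.pos_of_ne_zero hJ0)
  calc _ ≤ ∑ j ∈ Finset.range (J * k), (T j).card * (ρ * 2 ^ j) :=
        Finset.sum_le_sum_of_subset_of_nonneg (Finset.range_mono hkJ) fun j _ _ => by positivity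
    _ = ∑ s ∈ Finset.range J, ∑ q ∈ Finset.range k,
        (T (s + J * q)).card * (ρ * 2 ^ (s + J * q)) := sum_range_mul_eq_sum_sum _ J k
    _ ≤ ∑ s ∈ Finset.range J, 16 * n * β⁻¹ * (μH[1] (γ '' Icc 0 1)).toReal := by
        refine Finset.sum_le_sum fun s _ => ?_
        have e : ∀ j, ρ * 2 ^ s * ((2 : ℝ) ^ J) ^ j = ρ * 2 ^ (s + J * j) := fun j => by
          rw [pow_add, pow_mul, mul_assoc]
        obtain ⟨m, -, -, hle⟩ := exists_dominatesImages_of_flat_levels hγ hH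
          (ρ := ρ * 2 ^ s) (Λ := 2 ^ J) (by positivity) hA hβ hβ1 hJ hn
          (fun j => T (s + J * j)) (fun j => by rw [e]; exact hsep _)
          (fun j => by rw [e]; exact hflat _) (fun j => by rw [e]; exact hfar _) k
        have h1 : ∑ q ∈ Finset.range k, (T (s + J * q)).card *
            (β * (ρ * 2 ^ s * ((2 : ℝ) ^ J) ^ q) / (16 * n)) =
            (16 * n * β⁻¹)⁻¹ *
              ∑ q ∈ Finset.range k, (T (s + J * q)).card * (ρ * 2 ^ (s + J * q)) := by
          rw [Finset.mul_sum]
          refine Finset.sum_congr rfl fun q _ => ?_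
          rw [e]
          field_simp
        have h2 : 0 ≤ m.real univ := measureReal_nonneg
        rw [h1] at hle
        rw [← inv_mul_le_iff₀ (by positivity)]
        linarith
    _ = _ := by rw [Finset.sum_const, Finset.card_range, nsmul_eq_mul]; ring

end FlatSum

theorem summable_add_const_mul_half_pow (c : ℝ) :
    Summable fun M : ℕ => (M + c) * (1 / 2 : ℝ) ^ M := by
  have h1 : Summable fun M : ℕ => (M : ℝ) ^ 1 * (1 / 2 : ℝ) ^ M :=
    summable_pow_mul_geometric_of_norm_lt_one 1 (by norm_num)
  have h2 : Summable fun M : ℕ => c * (1 / 2 : ℝ) ^ M := summable_geometric_two.mul_left c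
  refine (h1.add h2).congr fun M => ?_
  ring

theorem exists_flat_weighted_sum_le {X : Type u} [NormedAddCommGroup X] [NormedSpace ℝ X]
    [MeasurableSpace X] [BorelSpace X] {p A : ℝ} (hp : 2 ≤ p) (hA : 0 ≤ A) :
    ∃ C : ℝ, 0 < C ∧ ∀ γ : ℝ → X, Continuous γ → μH[1] (γ '' Icc 0 1) < ⊤ → ∀ ρ : ℝ, 0 < ρ →
      ∀ b : ℕ → X → ℝ, ∀ T : ℕ → Finset X, (∀ j, ∀ x ∈ T j, 0 < b j x ∧ b j x ≤ 1) →
      (∀ j, ∀ x ∈ T j, ∀ y ∈ T j, x ≠ y → ρ * 2 ^ j ≤ dist x y) →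
      (∀ j, ∀ x ∈ T j, IsFlatAt γ (A + 2) (1 / 800 * b j x) (ρ * 2 ^ j) x) →
      (∀ j, ∀ x ∈ T j, IsFarFromLines (γ '' Icc 0 1) x (A * (ρ * 2 ^ j)) (b j x * (ρ * 2 ^ j))) →
      ∀ k : ℕ, ∑ j ∈ Finset.range k, ∑ x ∈ T j, b j x ^ p * (ρ * 2 ^ j) ≤
        C * (μH[1] (γ '' Icc 0 1)).toReal := by
  obtain ⟨n, hn⟩ := exists_nat_ge (40 * (A + 4))
  obtain ⟨J, hJ⟩ := pow_unbounded_of_one_lt (400 * (2 * A + 8)) one_lt_two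
  have hn0 : (0 : ℝ) < n := by linarith
  have hsum := summable_add_const_mul_half_pow (1 + J)
  set S := ∑' M : ℕ, (M + (1 + J : ℝ)) * (1 / 2 : ℝ) ^ M with hS
  have hS0 : 0 < S := hsum.tsum_pos (fun M => by positivity) 0 (by positivity)
  refine ⟨32 * n * S, by positivity, ?_⟩
  intro γ hγ hH ρ hρ b T hb hsep hflat hfar k
  set H := (μH[1] (γ '' Icc 0 1)).toReal with hHdef
  have hH0 : 0 ≤ H := ENNReal.toReal_nonneg
  have hex : ∀ j x, ∃ M : ℕ, x ∈ T j → (1 / 2 : ℝ) ^ (M + 1) < b j x ∧ b j x ≤ (1 / 2) ^ M := by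
    intro j x
    by_cases hx : x ∈ T j
    · obtain ⟨M, hM⟩ := exists_nat_pow_near_of_lt_one (hb j x hx).1 (hb j x hx).2
        (show (0 : ℝ) < 1 / 2 by norm_num) (by norm_num)
      exact ⟨M, fun _ => hM⟩
    · exact ⟨0, fun h => absurd h hx⟩
  choose μ hμ using hex
  set N := ((Finset.range k).sup fun j => (T j).sup (μ j)) + 1 with hN
  have hμN : ∀ j ∈ Finset.range k, ∀ x ∈ T j, μ j x ∈ Finset.range N := by
    intro j hj x hx
    have h1 : μ j x ≤ (T j).sup (μ j) := Finset.le_sup hx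
    have h2 : (T j).sup (μ j) ≤ (Finset.range k).sup fun j => (T j).sup (μ j) :=
      Finset.le_sup (f := fun j => (T j).sup (μ j)) hj
    exact Finset.mem_range.2 (by omega)
  have hlayer : ∀ M, ∑ j ∈ Finset.range k, ((T j).filter fun x => μ j x = M).card * (ρ * 2 ^ j) ≤
      16 * n * (M + (1 + J)) * 2 ^ (M + 1) * H := by
    intro M
    have hmem : ∀ {j x}, x ∈ (T j).filter (fun x => μ j x = M) →
        x ∈ T j ∧ (1 / 2 : ℝ) ^ (M + 1) < b j x ∧ b j x ≤ (1 / 2) ^ M := by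
      intro j x hx
      obtain ⟨hxT, rfl⟩ := Finset.mem_filter.1 hx
      exact ⟨hxT, hμ j x hxT⟩
    have h := flat_sum_le hγ hH hρ hA (β := (1 / 2) ^ (M + 1)) (by positivity)
      (pow_le_one₀ (by norm_num) (by norm_num)) (J := M + 1 + J)
      (by
        have h2 : (1 / 2 : ℝ) ^ (M + 1) * 2 ^ (M + 1) = 1 := by rw [← mul_pow]; norm_num
        rw [pow_add 2 (M + 1) J, ← mul_assoc, h2, one_mul]
        exact hJ.le) hn
      (fun j => (T j).filter fun x => μ j x = M)
      (fun j x hx y hy => hsep j x (hmem hx).1 y (hmem hy).1)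
      (fun j x hx => ⟨_, by
        have := (hmem hx).2.2
        rw [pow_succ]
        linarith, hflat j x (hmem hx).1⟩)
      (fun j x hx a v hv => by
        obtain ⟨y, hy, hyx, hyl⟩ := hfar j x (hmem hx).1 a v hv
        refine ⟨y, hy, hyx, le_trans ?_ hyl⟩
        have := (hmem hx).2.1.le
        gcongr) k
    refine h.trans (le_of_eq ?_)
    have h2 : ((1 / 2 : ℝ) ^ (M + 1))⁻¹ = 2 ^ (M + 1) := by rw [← inv_pow]; norm_num
    rw [h2, ← hHdef]
    push_cast
    ring
  calc ∑ j ∈ Finset.range k, ∑ x ∈ T j, b j x ^ p * (ρ * 2 ^ j)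
      = ∑ M ∈ Finset.range N, ∑ j ∈ Finset.range k,
          ∑ x ∈ T j with μ j x = M, b j x ^ p * (ρ * 2 ^ j) := by
        rw [Finset.sum_comm]
        exact Finset.sum_congr rfl fun j hj =>
          (Finset.sum_fiberwise_of_maps_to (hμN j hj) _).symm
    _ ≤ ∑ M ∈ Finset.range N, ∑ j ∈ Finset.range k,
          (1 / 4 : ℝ) ^ M * (((T j).filter fun x => μ j x = M).card * (ρ * 2 ^ j)) := by
        refine Finset.sum_le_sum fun M _ => Finset.sum_le_sum fun j _ => ?_
        have h1 : ∀ x ∈ (T j).filter fun x => μ j x = M,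
            b j x ^ p * (ρ * 2 ^ j) ≤ (1 / 4 : ℝ) ^ M * (ρ * 2 ^ j) := by
          intro x hx
          obtain ⟨hxT, rfl⟩ := Finset.mem_filter.1 hx
          have hb0 := (hb j x hxT).1
          have h2 : b j x ^ p ≤ b j x ^ (2 : ℝ) :=
            Real.rpow_le_rpow_of_exponent_ge hb0 (hb j x hxT).2 hp
          have h3 : b j x ^ (2 : ℝ) ≤ (1 / 4) ^ (μ j x) := by
            rw [Real.rpow_two]
            calc b j x ^ 2 ≤ ((1 / 2) ^ (μ j x)) ^ 2 := by
                  have := (hμ j x hxT).2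
                  gcongr
              _ = _ := by rw [← pow_mul, mul_comm, pow_mul]; norm_num
          gcongr
          exact h2.trans h3
        calc _ ≤ _ := Finset.sum_le_card_nsmul _ _ _ h1
          _ = _ := by rw [nsmul_eq_mul]; ring
    _ ≤ ∑ M ∈ Finset.range N, 32 * n * H * ((M + (1 + J : ℝ)) * (1 / 2 : ℝ) ^ M) := by
        refine Finset.sum_le_sum fun M _ => ?_
        rw [← Finset.mul_sum]
        calc _ ≤ (1 / 4 : ℝ) ^ M * (16 * n * (M + (1 + J)) * 2 ^ (M + 1) * H) := by
              gcongr
              exact hlayer M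
          _ = 32 * n * H * ((M + (1 + J : ℝ)) * ((1 / 4) * 2) ^ M) := by
              rw [mul_pow, pow_succ]
              ring
          _ = _ := by norm_num
    _ ≤ 32 * n * H * S := by
        rw [← Finset.mul_sum]
        gcongr
        exact hsum.sum_le_tsum _ fun M _ => by positivity
    _ = _ := by ring

section JonesBeta
variable {X : Type u} [NormedAddCommGroup X] [NormedSpace ℝ X]

theorem jonesBeta_nonneg (E Q : Set X) : 0 ≤ jonesBeta E Q := by
  unfold jonesBeta
  split_ifs
  · exact le_rfl
  · refine Real.sInf_nonneg ?_
    rintro _ ⟨a, v, -, rfl⟩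
    refine Real.sSup_nonneg ?_
    rintro _ ⟨x, -, rfl⟩
    have : 0 ≤ infDist x (lineThrough a v) := infDist_nonneg
    have : 0 ≤ Metric.diam Q := Metric.diam_nonneg
    positivity

theorem jonesBeta_le_of_forall_infDist_le {E Q : Set X} {a v : X} (hv : v ≠ 0) {δ : ℝ}
    (hδ : 0 ≤ δ) (h : ∀ y ∈ E ∩ Q, infDist y (lineThrough a v) ≤ δ) :
    jonesBeta E Q ≤ δ / Metric.diam Q := by
  have hd : 0 ≤ Metric.diam Q := Metric.diam_nonneg
  unfold jonesBeta
  split_ifs with hE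
  · positivity
  · refine (csInf_le ⟨0, ?_⟩ (Set.mem_ofPred.2 ⟨a, v, hv, rfl⟩)).trans ?_
    · rintro _ ⟨a, v, -, rfl⟩
      refine Real.sSup_nonneg ?_
      rintro _ ⟨x, -, rfl⟩
      have : 0 ≤ infDist x (lineThrough a v) := infDist_nonneg
      positivity
    · refine csSup_le ((nonempty_iff_ne_empty.2 hE).image _) ?_
      rintro _ ⟨x, hx, rfl⟩
      exact div_le_div_of_nonneg_right (h x hx) hd

theorem jonesBeta_le_of_forall_dist_le [Nontrivial X] {E Q : Set X} {x : X} {δ : ℝ}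
    (hδ : 0 ≤ δ) (h : ∀ y ∈ E ∩ Q, dist y x ≤ δ) : jonesBeta E Q ≤ δ / Metric.diam Q := by
  obtain ⟨v, hv⟩ := exists_ne (0 : X)
  exact jonesBeta_le_of_forall_infDist_le (a := x) hv hδ fun y hy =>
    (infDist_le_dist_of_mem (show x ∈ lineThrough x v from ⟨0, by simp⟩)).trans (h y hy)

theorem jonesBeta_closedBall_le_one [Nontrivial X] (E : Set X) (x : X) {R : ℝ} (hR : 0 < R) :
    jonesBeta E (closedBall x R) ≤ 1 := by
  refine (jonesBeta_le_of_forall_dist_le (E := E) (Q := closedBall x R) (x := x) hR.le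
    fun y hy => mem_closedBall.1 hy.2).trans ?_
  rw [Metric.diam_closedBall_eq x hR.le, div_le_one (by positivity)]
  linarith

theorem isFarFromLines_of_jonesBeta_pos [Nontrivial X] {E Γ : Set X} (hE : E ⊆ Γ) {x : X} {R : ℝ}
    (hR : 0 < R) (hβ : 0 < jonesBeta E (closedBall x R)) :
    IsFarFromLines Γ x R (jonesBeta E (closedBall x R) * R) := by
  intro a v hv
  by_contra! h
  have h1 := jonesBeta_le_of_forall_infDist_le (E := E) (Q := closedBall x R) (a := a) hv
    (by positivity) fun y hy => (h y (hE hy.1) hy.2).le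
  rw [Metric.diam_closedBall_eq x hR.le] at h1
  have h2 : jonesBeta E (closedBall x R) * R / (2 * R) = jonesBeta E (closedBall x R) / 2 := by
    field_simp
  rw [h2] at h1
  linarith

end JonesBeta

theorem exists_weighted_sum_le {X : Type u} [NormedAddCommGroup X] [NormedSpace ℝ X]
    [MeasurableSpace X] [BorelSpace X] {p c A : ℝ} (hp : 2 ≤ p) (hc : 0 < c)
    (hX : HasExcessBound X p c) (hA : 0 ≤ A) :
    ∃ C : ℝ, 0 < C ∧ ∀ (γ : ℝ → X) (L : ℝ≥0), LipschitzWith L γ →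
      μH[1] (γ '' Icc 0 1) < ⊤ → ∀ ρ : ℝ, 0 < ρ →
      ∀ b : ℕ → X → ℝ, (∀ j x, 0 ≤ b j x) → (∀ j x, b j x ≤ 1) →
      ∀ T : ℕ → Finset X, (∀ j, ∀ x ∈ T j, x ∈ γ '' Icc 0 1) →
      (∀ j, ∀ x ∈ T j, ∀ y ∈ T j, x ≠ y → ρ * 2 ^ j ≤ dist x y) →
      (∀ j, ∀ x ∈ T j, 0 < b j x →
        IsFarFromLines (γ '' Icc 0 1) x (A * (ρ * 2 ^ j)) (b j x * (ρ * 2 ^ j))) →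
      ∀ k : ℕ, ∑ j ∈ Finset.range k, ∑ x ∈ T j, b j x ^ p * (ρ * 2 ^ j) ≤
        C * (L + ρ * 2 ^ k + (μH[1] (γ '' Icc 0 1)).toReal) := by
  obtain ⟨C₁, hC₁, h₁⟩ := exists_nonflat_sum_le hp hc hX (K := A + 2) (ε₁ := 1 / 800)
    (by norm_num) (by norm_num)
  obtain ⟨C₂, hC₂, h₂⟩ := exists_flat_weighted_sum_le (X := X) hp hA
  refine ⟨C₁ + C₂, by positivity, ?_⟩
  intro γ L hγ hH ρ hρ b hb hb1 T hT hsep hfar k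
  have e₁ := h₁ γ L hγ ρ hρ b hb hb1 T hT hsep k
  have hmem : ∀ {j x}, x ∈ ((T j).filter fun x => 0 < b j x ∧
      IsFlatAt γ (A + 2) (1 / 800 * b j x) (ρ * 2 ^ j) x) → x ∈ T j ∧ 0 < b j x ∧
      IsFlatAt γ (A + 2) (1 / 800 * b j x) (ρ * 2 ^ j) x := fun h => Finset.mem_filter.1 h
  have e₂ := h₂ γ hγ.continuous hH ρ hρ b (fun j => (T j).filter fun x => 0 < b j x ∧
      IsFlatAt γ (A + 2) (1 / 800 * b j x) (ρ * 2 ^ j) x)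
    (fun j x hx => ⟨(hmem hx).2.1, hb1 j x⟩)
    (fun j x hx y hy => hsep j x (hmem hx).1 y (hmem hy).1)
    (fun j x hx => (hmem hx).2.2)
    (fun j x hx => hfar j x (hmem hx).1 (hmem hx).2.1) k
  have hsplit : ∀ j, ∑ x ∈ T j, b j x ^ p * (ρ * 2 ^ j) =
      (∑ x ∈ T j with ¬ IsFlatAt γ (A + 2) (1 / 800 * b j x) (ρ * 2 ^ j) x,
        b j x ^ p * (ρ * 2 ^ j)) +
      ∑ x ∈ T j with (0 < b j x ∧ IsFlatAt γ (A + 2) (1 / 800 * b j x) (ρ * 2 ^ j) x),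
        b j x ^ p * (ρ * 2 ^ j) := by
    intro j
    rw [← Finset.sum_filter_not_add_sum_filter (T j)
      (fun x => IsFlatAt γ (A + 2) (1 / 800 * b j x) (ρ * 2 ^ j) x)]
    congr 1
    symm
    refine Finset.sum_subset (fun x hx => ?_) fun x hx hx' => ?_
    · exact Finset.mem_filter.2 ⟨(hmem hx).1, (hmem hx).2.2⟩
    · obtain ⟨hxT, hxf⟩ := Finset.mem_filter.1 hx
      have : b j x = 0 := by
        by_contra hne
        exact hx' (Finset.mem_filter.2 ⟨hxT, lt_of_le_of_ne (hb j x) (Ne.symm hne), hxf⟩)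
      rw [this, Real.zero_rpow (by linarith), zero_mul]
  rw [Finset.sum_congr rfl fun j _ => hsplit j, Finset.sum_add_distrib]
  have h0 : 0 ≤ (μH[1] (γ '' Icc 0 1)).toReal := ENNReal.toReal_nonneg
  have h3 : (0 : ℝ) ≤ L := L.2
  have h4 : 0 ≤ C₁ * (μH[1] (γ '' Icc 0 1)).toReal := by positivity
  have h5 : 0 ≤ C₂ * (L + ρ * 2 ^ k) := by positivity
  linarith

theorem ENNReal.tsum_int_le_of_sum_range_le {a : ℤ → ℝ≥0∞} (N : ℤ) {B₁ B₂ : ℝ≥0∞}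
    (h₁ : ∀ n : ℕ, ∑ i ∈ Finset.range n, a (N + i) ≤ B₁)
    (h₂ : ∑' i : ℕ, a (N - (i + 1)) ≤ B₂) : ∑' k, a k ≤ B₁ + B₂ := by
  rw [← (Equiv.addLeft N).tsum_eq a, tsum_of_nat_of_neg_add_one ENNReal.summable
    ENNReal.summable]
  exact add_le_add (ENNReal.tsum_le_of_sum_range_le h₁) h₂

theorem tsum_ofReal_subtype_eq_sum {α : Type*} {S : Set α} (hS : S.Finite) {f : α → ℝ}
    (hf : ∀ x, 0 ≤ f x) :
    ∑' x : S, ENNReal.ofReal (f x) = ENNReal.ofReal (∑ x ∈ hS.toFinset, f x) := by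
  rw [ENNReal.ofReal_sum_of_nonneg fun x _ => hf x,
    ← Finset.tsum_subtype' hS.toFinset fun x => ENNReal.ofReal (f x), hS.coe_toFinset]

theorem IsCompact.finite_of_forall_le_dist {X : Type*} [MetricSpace X] {Γ S : Set X}
    (hΓ : IsCompact Γ) (hS : S ⊆ Γ) {r : ℝ} (hr : 0 < r)
    (h : ∀ x ∈ S, ∀ y ∈ S, x ≠ y → r ≤ dist x y) : S.Finite := by
  have hcl : IsClosed S := Metric.isClosed_of_pairwise_le_dist hr
    fun x hx y hy hxy => h x hx y hy hxy
  have : DiscreteTopology S := DiscreteTopology.of_forall_le_dist hr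
    fun x y hxy => h x x.2 y y.2 fun h' => hxy (Subtype.ext h')
  exact (hΓ.of_isClosed_subset hcl hS).finite ⟨this⟩

section Assembly

variable {X : Type u} [NormedAddCommGroup X] [NormedSpace ℝ X]

/-- At scales larger than the diameter of the set, the net has at most one point and the beta
number is at most the ratio of the diameter to the scale. -/
theorem tsum_jonesBeta_le_of_lt [Nontrivial X] {p A D r : ℝ} (hp : 2 ≤ p) (hA : 1 < A)
    {E S : Set X} (hS : S ⊆ E) (hD : 0 ≤ D) (hE : ∀ x ∈ E, ∀ y ∈ E, dist x y ≤ D) (hr : D < r)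
    (hsep : ∀ x ∈ S, ∀ y ∈ S, x ≠ y → r ≤ dist x y) :
    ∑' x : S, ENNReal.ofReal (jonesBeta E (closedBall (x : X) (A * r)) ^ p *
      Metric.diam (closedBall (x : X) (A * r))) ≤ ENNReal.ofReal (D * (D / r)) := by
  have hr0 : 0 < r := hD.trans_lt hr
  have hAr : 0 < A * r := by positivity
  have hsub : S.Subsingleton := by
    intro x hx y hy
    by_contra hxy
    linarith [hsep x hx y hy hxy, hE x (hS hx) y (hS hy)]
  have key : ∀ x ∈ E, jonesBeta E (closedBall x (A * r)) ^ p *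
      Metric.diam (closedBall x (A * r)) ≤ D * (D / r) := by
    intro x hx
    have hβ := jonesBeta_le_of_forall_dist_le (E := E) (Q := closedBall x (A * r)) (x := x) hD
      fun y hy => hE y hy.1 x hx
    have h0 := jonesBeta_nonneg E (closedBall x (A * r))
    have h1 := jonesBeta_closedBall_le_one E x hAr
    rw [Metric.diam_closedBall_eq x hAr.le] at hβ ⊢
    set β := jonesBeta E (closedBall x (A * r))
    have h2 : β ^ p ≤ β ^ (2 : ℝ) := by
      rcases h0.eq_or_lt with h | h
      · rw [← h, Real.zero_rpow (by linarith), Real.zero_rpow (by norm_num)]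
      · exact Real.rpow_le_rpow_of_exponent_ge h h1 hp
    rw [Real.rpow_two] at h2
    have h3 : β * (2 * (A * r)) ≤ D := (le_div_iff₀ (by positivity)).1 hβ
    have h4 : β ≤ D / r := hβ.trans (by gcongr; nlinarith)
    calc β ^ p * (2 * (A * r)) ≤ β ^ 2 * (2 * (A * r)) := by gcongr
      _ = (β * (2 * (A * r))) * β := by ring
      _ ≤ D * (D / r) := by gcongr
  rcases hsub.eq_empty_or_singleton with rfl | ⟨x, rfl⟩
  · simp
  · rw [tsum_fintype, Fintype.sum_unique]
    exact ENNReal.ofReal_le_ofReal (key x (hS rfl))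

theorem exists_SEp_le [Nontrivial X] [MeasurableSpace X] [BorelSpace X] {p c A : ℝ}
    (hp : 2 ≤ p) (hc : 0 < c) (hX : HasExcessBound X p c) (hA : 1 < A) :
    ∃ C : ℝ, 0 < C ∧ ∀ (Γ E : Set X) (net : ℤ → Set X), IsRectifiableCurve Γ → E ⊆ Γ →
      IsPartialMultiresolution E net → SEp E net A p ≤ ENNReal.ofReal C * μH[1] Γ := by
  obtain ⟨C, hC, hsum⟩ := exists_weighted_sum_le (A := A) hp hc hX (by linarith)
  refine ⟨1 + 22 * A * C + 2, by positivity, ?_⟩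
  rintro Γ E net ⟨⟨f, hf, hΓf⟩, hH⟩ hE ⟨hnetE, -, hsep⟩
  have hcpt : IsCompact Γ := hΓf ▸ isCompact_Icc.image_of_continuousOn hf
  have hconn : IsConnected Γ := hΓf ▸ (isConnected_Icc zero_le_one).image f hf
  set H := (μH[1] Γ).toReal with hHdef
  have hH0 : 0 ≤ H := ENNReal.toReal_nonneg
  have hdist : ∀ x ∈ Γ, ∀ y ∈ Γ, dist x y ≤ Metric.diam Γ := fun x hx y hy =>
    dist_le_diam_of_mem hcpt.isBounded hx hy
  set D := Metric.diam Γ with hDdef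
  have hD0 : 0 ≤ D := Metric.diam_nonneg
  have hDH : D ≤ H := by
    refine diam_le_of_forall_dist_le hH0 fun x hx y hy => ?_
    rw [hHdef, ← ENNReal.ofReal_le_iff_le_toReal hH.ne]
    exact ofReal_dist_le_hausdorffMeasure hconn.isPreconnected hy hx
  have hDE : Metric.diam E ≤ D := Metric.diam_mono hE hcpt.isBounded
  have hEdist : ∀ x ∈ E, ∀ y ∈ E, dist x y ≤ D := fun x hx y hy => hdist x (hE hx) y (hE hy)
  have h2 : (0 : ℝ) < 2 := two_pos
  suffices hb : betaSum E net A p ≤ ENNReal.ofReal (22 * A * C * H) + ENNReal.ofReal (2 * H) by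
    calc SEp E net A p
        ≤ ENNReal.ofReal H + (ENNReal.ofReal (22 * A * C * H) + ENNReal.ofReal (2 * H)) :=
          add_le_add (ENNReal.ofReal_le_ofReal (hDE.trans hDH)) hb
      _ = ENNReal.ofReal ((1 + 22 * A * C + 2) * H) := by
          rw [← ENNReal.ofReal_add (by positivity) (by positivity),
            ← ENNReal.ofReal_add (by positivity) (by positivity)]
          congr 1; ring
      _ = ENNReal.ofReal (1 + 22 * A * C + 2) * μH[1] Γ := by
          rw [ENNReal.ofReal_mul (by positivity), hHdef, ENNReal.ofReal_toReal hH.ne]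
  rcases hD0.eq_or_lt with hDz | hDpos
  · have hz : betaSum E net A p ≤ ∑' _ : ℤ, 0 := by
      refine ENNReal.tsum_le_tsum fun k => ?_
      have := tsum_jonesBeta_le_of_lt hp hA (hnetE k) hD0 hEdist
        (r := (2 : ℝ) ^ (-k)) (by rw [← hDz]; positivity) (hsep k)
      simpa [← hDz] using this
    exact (hz.trans_eq tsum_zero).trans zero_le
  obtain ⟨N, hN⟩ : ∃ N : ℤ, D ∈ Ico ((2 : ℝ) ^ (-N)) ((2 : ℝ) ^ (-N + 1)) := by
    obtain ⟨n, hn⟩ := exists_mem_Ico_zpow hDpos (one_lt_two (α := ℝ))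
    exact ⟨-n, by simpa using hn⟩
  have hfin : ∀ k, (net k).Finite := fun k =>
    hcpt.finite_of_forall_le_dist ((hnetE k).trans hE) (by positivity) (hsep k)
  obtain ⟨γ, L, hγ, hγΓ, hL⟩ : ∃ (γ : ℝ → X) (L : ℝ≥0), LipschitzWith L γ ∧
      γ '' Icc 0 1 = Γ ∧ (L : ℝ) = 8 * H := by
    obtain ⟨a, ha, b, hb, hab⟩ : ∃ a ∈ Γ, ∃ b ∈ Γ, a ≠ b := by
      by_contra! h
      exact hDpos.ne' (Metric.diam_subsingleton fun a ha b hb => h a ha b hb)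
    obtain ⟨γ, h1, -, h3⟩ := exists_lipschitz_parametrization hcpt hconn hH ha hb hab
    exact ⟨γ, ⟨8 * H, by positivity⟩, LipschitzWith.of_dist_le_mul h1, h3.symm, rfl⟩
  refine ENNReal.tsum_int_le_of_sum_range_le N (fun n => ?_) ?_
  · simp only [fun k => tsum_ofReal_subtype_eq_sum (hfin k)
      (f := fun x => jonesBeta E (closedBall x (A * (2 : ℝ) ^ (-k))) ^ p *
        Metric.diam (closedBall x (A * (2 : ℝ) ^ (-k))))
      fun x => mul_nonneg (Real.rpow_nonneg (jonesBeta_nonneg _ _) _) Metric.diam_nonneg]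
    rw [← ENNReal.ofReal_sum_of_nonneg fun i _ => Finset.sum_nonneg fun x _ =>
      mul_nonneg (Real.rpow_nonneg (jonesBeta_nonneg _ _) _) Metric.diam_nonneg]
    refine ENNReal.ofReal_le_ofReal ?_
    rcases n with _ | m
    · simp only [Finset.range_zero, Finset.sum_empty]; positivity
    have hscale : ∀ j : ℕ, (2 : ℝ) ^ (-(N + m)) * 2 ^ j = 2 ^ (-(N + m - j)) := by
      intro j
      rw [← zpow_natCast, ← zpow_add₀ h2.ne']
      congr 1; ring
    have hpos : ∀ j : ℕ, (0 : ℝ) < 2 ^ (-(N + m - j)) := fun j => by positivity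
    have hb := hsum γ L hγ (hγΓ ▸ hH) (2 ^ (-(N + m))) (by positivity)
      (fun j x => jonesBeta E (closedBall x (A * 2 ^ (-(N + m - j)))))
      (fun j x => jonesBeta_nonneg _ _)
      (fun j x => jonesBeta_closedBall_le_one E x (mul_pos (by linarith) (hpos j)))
      (fun j => (hfin (N + m - j)).toFinset)
      (fun j x hx => hγΓ ▸ hE (hnetE _ ((Set.Finite.mem_toFinset _).1 hx)))
      (fun j x hx y hy hxy => by
        rw [hscale]
        exact hsep _ x ((Set.Finite.mem_toFinset _).1 hx) y ((Set.Finite.mem_toFinset _).1 hy) hxy)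
      (fun j x _ hβ a v hv => by
        obtain ⟨y, hy, hyx, hyd⟩ := isFarFromLines_of_jonesBeta_pos (hγΓ ▸ hE)
          (mul_pos (by linarith) (hpos j)) hβ a v hv
        refine ⟨y, hy, hyx.trans_eq (by rw [hscale]), le_trans ?_ hyd⟩
        rw [hscale]
        have := hpos j
        gcongr
        nlinarith) (m + 1)
    rw [hγΓ, hL] at hb
    have htop : (2 : ℝ) ^ (-(N + m)) * 2 ^ (m + 1) ≤ 2 * D := by
      rw [hscale]
      have : (2 : ℝ) ^ (-(N + m - ((m + 1 : ℕ) : ℤ))) = 2 * 2 ^ (-N) := by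
        rw [← zpow_one_add₀ h2.ne']
        congr 1; push_cast; ring
      rw [this]
      linarith [hN.1]
    calc _ = ∑ j ∈ Finset.range (m + 1), ∑ x ∈ (hfin (N + m - j)).toFinset,
          jonesBeta E (closedBall x (A * 2 ^ (-(N + m - j)))) ^ p *
            Metric.diam (closedBall x (A * 2 ^ (-(N + m - j)))) := by
          rw [← Finset.sum_range_reflect]
          refine Finset.sum_congr rfl fun j hj => ?_
          have hj' : N + ((m + 1 - 1 - j : ℕ) : ℤ) = N + m - j := by
            have := Finset.mem_range.1 hj
            omega
          simp only [hj']
      _ = 2 * A * ∑ j ∈ Finset.range (m + 1), ∑ x ∈ (hfin (N + m - j)).toFinset,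
          jonesBeta E (closedBall x (A * 2 ^ (-(N + m - j)))) ^ p *
            (2 ^ (-(N + m)) * 2 ^ j) := by
          simp only [Finset.mul_sum]
          refine Finset.sum_congr rfl fun j _ => Finset.sum_congr rfl fun x _ => ?_
          rw [hscale, Metric.diam_closedBall_eq x (mul_pos (by linarith) (hpos j)).le]
          ring
      _ ≤ 2 * A * (C * (8 * H + 2 ^ (-(N + m)) * 2 ^ (m + 1) + H)) := by gcongr
      _ ≤ 2 * A * (C * (8 * H + 2 * H + H)) := by gcongr 2 * A * (C * (?_ + H)); linarith
      _ = 22 * A * C * H := by ring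
  · have hterm : ∀ i : ℕ, ∑' x : net (N - (i + 1)),
        ENNReal.ofReal (jonesBeta E (closedBall (x : X) (A * (2 : ℝ) ^ (-(N - (i + 1))))) ^ p *
          Metric.diam (closedBall (x : X) (A * (2 : ℝ) ^ (-(N - (i + 1)))))) ≤
        ENNReal.ofReal (D * (1 / 2) ^ i) := by
      intro i
      have hr : (2 : ℝ) ^ (-(N - (i + 1 : ℤ))) = 2 ^ (-N + 1) * 2 ^ i := by
        rw [← zpow_natCast, ← zpow_add₀ h2.ne']
        congr 1; ring
      have h1 : (1 : ℝ) ≤ 2 ^ i := one_le_pow₀ one_le_two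
      have hlt : D < (2 : ℝ) ^ (-(N - (i + 1 : ℤ))) := by
        rw [hr]; nlinarith [hN.2]
      refine (tsum_jonesBeta_le_of_lt hp hA (hnetE _) hD0 hEdist hlt (hsep _)).trans
        (ENNReal.ofReal_le_ofReal ?_)
      gcongr
      rw [hr, div_le_iff₀ (by positivity), one_div, inv_pow]
      have : (2 ^ i : ℝ)⁻¹ * (2 ^ (-N + 1) * 2 ^ i) = 2 ^ (-N + 1) := by field_simp
      rw [this]
      exact hN.2.le
    refine (ENNReal.tsum_le_tsum hterm).trans ?_
    rw [← ENNReal.ofReal_tsum_of_nonneg (fun i => by positivity)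
      (summable_geometric_two.mul_left D), tsum_mul_left, tsum_geometric_two]
    exact ENNReal.ofReal_le_ofReal (by linarith)

end Assembly

instance ellp_nontrivial {p : ℝ} [Fact (1 ≤ ENNReal.ofReal p)] : Nontrivial (ellp p) := by
  refine ⟨⟨lp.single _ 0 1, 0, fun h => ?_⟩⟩
  have := congrArg (fun x : ellp p => x 0) h
  simp at this

/-- Sharpness of the exponent from below in `ℓ_p`, `2 ≤ p < ∞`: the necessary-side
estimate `S_{E,p}(G) ≤ C·H¹(Γ)` holds in `ℓ_p` with exponent `p`. -/
theorem statement17 (p A : ℝ) (hp : 2 ≤ p) (hA : 1 < A) :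
    letI : Fact (1 ≤ ENNReal.ofReal p) := ⟨ENNReal.one_le_ofReal.mpr (by linarith)⟩
    ∀ [MeasurableSpace (ellp p)] [BorelSpace (ellp p)],
      ∃ C : ℝ, 0 < C ∧
        ∀ (Γ E : Set (ellp p)) (net : ℤ → Set (ellp p)),
          IsRectifiableCurve Γ → E.Nonempty → E ⊆ Γ → IsPartialMultiresolution E net →
          SEp E net A p ≤ ENNReal.ofReal C * μH[1] Γ := by
  have : Fact (1 ≤ ENNReal.ofReal p) := ⟨ENNReal.one_le_ofReal.mpr (by linarith)⟩
  intro _ _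
  obtain ⟨C, hC, h⟩ := exists_SEp_le (X := ellp p) hp (by positivity)
    (hasExcessBound_of_clarkson hp (ellp_clarkson hp)) hA
  exact ⟨C, hC, fun Γ E net hΓ _ hE hnet => h Γ E net hΓ hE hnet⟩

end
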